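/- arXiv:1206.6690 — 6 statements merged into one kernel-verified Lean document; each statement's English description precedes it below -/
import Mathlib

section
/- Let G be a bridgeless cubic graph of order n. If G has a cycle of length at least n − 8, then G has a 6-CDC. -/
open scoped Classical

namespace SnarkPaper

variable {V : Type*}

/-- A graph is cubic if every vertex has exactly 3 neighbours. -/
def IsCubic (G : SimpleGraph V) : Prop := ∀ v : V, (G.neighborSet v).ncard = 3

/-- A proper 3-edge-colouring: edges sharing an endpoint get different colours. -/
def Colourable3 (G : SimpleGraph V) : Prop :=
  ∃ c : Sym2 V → Fin 3, ∀ e₁ ∈ G.edgeSet, ∀ e₂ ∈ G.edgeSet,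
    e₁ ≠ e₂ → (∃ v, v ∈ e₁ ∧ v ∈ e₂) → c e₁ ≠ c e₂

/-- A subgraph is 2-regular if every one of its vertices has exactly two neighbours in it. -/
def IsTwoRegular {G : SimpleGraph V} (H : G.Subgraph) : Prop :=
  ∀ v ∈ H.verts, (H.neighborSet v).ncard = 2

/-- A cycle is a connected 2-regular subgraph. -/
def IsCycleSub {G : SimpleGraph V} (C : G.Subgraph) : Prop :=
  C.Connected ∧ IsTwoRegular C

/-- A 2-factor is a spanning 2-regular subgraph. -/
def IsTwoFactor {G : SimpleGraph V} (F : G.Subgraph) : Prop :=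
  F.IsSpanning ∧ IsTwoRegular F

/-- A 2-factor is even if all its cycles (connected components) have even length. -/
def IsEvenTwoFactor {G : SimpleGraph V} (F : G.Subgraph) : Prop :=
  IsTwoFactor F ∧ ∀ C : G.Subgraph, C ≤ F → IsCycleSub C → Even C.verts.ncard

/-- An even subgraph: every vertex has even degree. -/
def IsEvenSubgraph {G : SimpleGraph V} (H : G.Subgraph) : Prop :=
  ∀ v : V, Even (H.neighborSet v).ncard

/-- A cycle double cover: a multiset of cycles covering each edge exactly twice. -/
def IsCDC (G : SimpleGraph V) (D : Multiset G.Subgraph) : Prop :=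
  (∀ C ∈ D, IsCycleSub C) ∧
  ∀ e ∈ G.edgeSet, D.countP (fun C => e ∈ C.edgeSet) = 2

/-- A k-CDC, seen as a multiset of k even subgraphs covering each edge exactly twice. -/
def IsKCDC (G : SimpleGraph V) (k : ℕ) (D : Multiset G.Subgraph) : Prop :=
  D.card = k ∧ (∀ H ∈ D, IsEvenSubgraph H) ∧
  ∀ e ∈ G.edgeSet, D.countP (fun H => e ∈ H.edgeSet) = 2

/-- An edge set is even if every vertex meets an even number of its edges. -/
def EvenEdgeSet (S : Set (Sym2 V)) : Prop :=
  ∀ v : V, Even {w : V | s(v, w) ∈ S}.ncard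

/-- A k-CDC presented as a multiset of k even edge sets covering each edge exactly twice. -/
def IsKCDCEdgeSets (G : SimpleGraph V) (k : ℕ) (D : Multiset (Set (Sym2 V))) : Prop :=
  D.card = k ∧ (∀ S ∈ D, S ⊆ G.edgeSet ∧ EvenEdgeSet S) ∧
  ∀ e ∈ G.edgeSet, D.countP (fun S => e ∈ S) = 2

/-- The set A contains (the vertices of) a cycle of G. -/
def HasCycleIn (G : SimpleGraph V) (A : Set V) : Prop :=
  ∃ C : G.Subgraph, IsCycleSub C ∧ C.verts ⊆ A

/-- The edges of G crossing between A and its complement. -/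
def cutEdges (G : SimpleGraph V) (A : Set V) : Set (Sym2 V) :=
  {e ∈ G.edgeSet | ∃ x ∈ A, ∃ y ∉ A, e = s(x, y)}

/-- Cyclically k-edge-connected: every edge cut separating two cycles has at least k edges. -/
def CyclEdgeConn (G : SimpleGraph V) (k : ℕ) : Prop :=
  ∀ A : Set V, HasCycleIn G A → HasCycleIn G Aᶜ → k ≤ (cutEdges G A).ncard

/-- A snark: an uncolourable cyclically 4-edge-connected cubic graph with girth at least 5. -/
def IsSnark (G : SimpleGraph V) : Prop :=
  IsCubic G ∧ ¬ Colourable3 G ∧ CyclEdgeConn G 4 ∧ 5 ≤ G.girth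

/-- The edge-insertion operation applied to the edges ab and cd of G: subdivide each with a
new vertex (u = inr 0, v = inr 1) and join the two new vertices by an edge. -/
def edgeInsertion (G : SimpleGraph V) (a b c d : V) : SimpleGraph (V ⊕ Fin 2) :=
  SimpleGraph.fromEdgeSet
    ((Sym2.map Sum.inl '' (G.edgeSet \ {s(a, b), s(c, d)})) ∪
      {s(Sum.inl a, Sum.inr 0), s(Sum.inr 0, Sum.inl b),
       s(Sum.inl c, Sum.inr 1), s(Sum.inr 1, Sum.inl d),
       s(Sum.inr 0, Sum.inr 1)})

/-- A permutation graph: a cubic graph with a 2-factor consisting of two induced cycles. -/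
def IsPermutationGraph (G : SimpleGraph V) : Prop :=
  IsCubic G ∧ ∃ C₁ C₂ : G.Subgraph, IsCycleSub C₁ ∧ IsCycleSub C₂ ∧
    C₁.IsInduced ∧ C₂.IsInduced ∧ Disjoint C₁.verts C₂.verts ∧ IsTwoFactor (C₁ ⊔ C₂)

/-- The total weight of the edge cut determined by A. -/
noncomputable def cutWeight (G : SimpleGraph V) (w : Sym2 V → ℕ) (A : Set V) : ℕ :=
  ∑ᶠ e ∈ cutEdges G A, w e

/-- An eulerian (1,2)-weight: each edge gets weight 1 or 2 and every edge cut has even weight. -/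
def IsEulerianWeight (G : SimpleGraph V) (w : Sym2 V → ℕ) : Prop :=
  (∀ e ∈ G.edgeSet, w e = 1 ∨ w e = 2) ∧ ∀ A : Set V, Even (cutWeight G w A)

/-- A compatible cycle cover of (G, w): each edge e lies in exactly w(e) of the cycles. -/
def IsCompatibleCycleCover (G : SimpleGraph V) (w : Sym2 V → ℕ)
    (D : Multiset G.Subgraph) : Prop :=
  (∀ C ∈ D, IsCycleSub C) ∧
  ∀ e ∈ G.edgeSet, D.countP (fun C => e ∈ C.edgeSet) = w e



lemma sum_fibre_zero {I : Type*} [Fintype I] [DecidableEq I] (g : (I → Fin 3) → ZMod 2) (v : I)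
    (h : ∀ σ, ∑ a, g (Function.update σ v a) = 0) : ∑ σ, g σ = 0 := by
  have h1 : ∀ a : Fin 3, ∑ σ : I → Fin 3, g (Function.update σ v (σ v + a)) = ∑ σ, g σ := by
    intro a
    apply Fintype.sum_bijective (fun σ : I → Fin 3 => Function.update σ v (σ v + a))
    · refine Function.bijective_iff_has_inverse.mpr
        ⟨fun σ => Function.update σ v (σ v - a), fun σ => ?_, fun σ => ?_⟩ <;> simp
    · intro σ; rfl
  have h2 : ∑ a : Fin 3, ∑ σ : I → Fin 3, g (Function.update σ v (σ v + a)) = 0 := by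
    rw [Finset.sum_comm]
    apply Finset.sum_eq_zero
    intro σ _
    rw [← h σ]
    exact Fintype.sum_bijective (fun a => σ v + a) (AddGroup.addLeft_bijective (σ v)) _ _
      (fun _ => rfl)
  simp only [h1] at h2
  rw [Finset.sum_const] at h2
  simp only [Finset.card_univ, Fintype.card_fin] at h2
  have : (3 : ℕ) • (∑ σ, g σ) = ∑ σ, g σ := by
    generalize ∑ σ, g σ = z
    revert z; decide
  rw [← this]; exact h2

lemma odd_count {I : Type*} [Fintype I] [DecidableEq I] (M : (I → Fin 3) → I → I → ZMod 2)
    (hsymm : ∀ σ v w, M σ v w = M σ w v) (hdiag : ∀ σ v, M σ v v = 1)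
    (hdep : ∀ σ v w u a, u ≠ v → u ≠ w → M (Function.update σ u a) v w = M σ v w)
    (hsum : ∀ σ v w, v ≠ w → ∑ a, M (Function.update σ v a) v w = 0) :
    ∃ σ, ∀ v, ∑ w, M σ v w = 1 := by
  by_contra hcon
  push Not at hcon
  have hz : ∑ σ : I → Fin 3, ∏ v, ∑ w, M σ v w = 0 := by
    apply Finset.sum_eq_zero
    intro σ _
    obtain ⟨v, hv⟩ := hcon σ
    apply Finset.prod_eq_zero (Finset.mem_univ v)
    revert hv
    generalize ∑ w, M σ v w = z
    revert z; decide
  have h1 : ∑ σ : I → Fin 3, ∏ v, ∑ w, M σ v w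
      = ∑ f : I → I, ∑ σ : I → Fin 3, ∏ v, M σ v (f v) := by
    rw [Finset.sum_comm]
    refine Finset.sum_congr rfl fun σ _ => ?_
    rw [Finset.prod_univ_sum]
    simp
  -- non-injective functions vanish
  have h2 : ∀ f : I → I, ¬ Function.Bijective f → ∑ σ : I → Fin 3, ∏ v, M σ v (f v) = 0 := by
    intro f hf
    have : ¬ Function.Surjective f := fun hs => hf ⟨Finite.injective_iff_surjective.mpr hs, hs⟩
    simp only [Function.Surjective] at this
    push Not at this
    obtain ⟨v, hv⟩ := this
    apply sum_fibre_zero _ v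
    intro σ
    have : ∀ a, ∏ u, M (Function.update σ v a) u (f u)
        = M (Function.update σ v a) v (f v) * ∏ u ∈ Finset.univ.erase v, M σ u (f u) := by
      intro a
      rw [← Finset.mul_prod_erase _ _ (Finset.mem_univ v)]
      congr 1
      apply Finset.prod_congr rfl
      intro u hu
      exact hdep _ _ _ _ _ (Finset.ne_of_mem_erase hu).symm (hv u).symm
    simp only [this]
    rw [← Finset.sum_mul, hsum σ v (f v) (hv v).symm, zero_mul]
  have h3 : ∑ f : I → I, ∑ σ : I → Fin 3, ∏ v, M σ v (f v)
      = ∑ π : Equiv.Perm I, ∑ σ : I → Fin 3, ∏ v, M σ v (π v) := by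
    rw [← Finset.sum_filter_of_ne (p := fun f : I → I => Function.Bijective f)]
    · symm
      apply Finset.sum_bij (fun (π : Equiv.Perm I) _ => (π : I → I))
      · intro π _; simp
      · intro a _ b _ h; exact DFunLike.coe_injective h
      · intro f hf
        simp only [Finset.mem_filter, Finset.mem_univ, true_and] at hf
        exact ⟨Equiv.ofBijective f hf, Finset.mem_univ _, rfl⟩
      · intro π _; rfl
    · intro f _ hf
      by_contra hb
      exact hf (h2 f hb)
  have h4 : ∑ π : Equiv.Perm I, ∑ σ : I → Fin 3, ∏ v, M σ v (π v) = 1 := by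
    rw [← Finset.add_sum_erase _ _ (Finset.mem_univ (1 : Equiv.Perm I))]
    have e1 : ∑ σ : I → Fin 3, ∏ v, M σ v ((1 : Equiv.Perm I) v) = 1 := by
      simp only [Equiv.Perm.coe_one, id_eq, hdiag, Finset.prod_const_one]
      simp only [Finset.sum_const, Finset.card_univ, Fintype.card_pi, Fintype.card_fin,
        Finset.prod_const, nsmul_eq_mul, mul_one]
      push_cast
      have : (3 : ZMod 2) = 1 := by decide
      rw [this, one_pow]
    have e2 : ∑ π ∈ Finset.univ.erase (1 : Equiv.Perm I),
        ∑ σ : I → Fin 3, ∏ v, M σ v (π v) = 0 := by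
      apply Finset.sum_involution (fun π _ => π⁻¹)
      · intro π _
        have : ∑ σ : I → Fin 3, ∏ v, M σ v (π⁻¹ v) = ∑ σ : I → Fin 3, ∏ v, M σ v (π v) := by
          refine Finset.sum_congr rfl fun σ _ => ?_
          rw [← Equiv.prod_comp π]
          refine Finset.prod_congr rfl fun v _ => ?_
          simp [hsymm σ (π v) v]
        rw [this]
        exact CharTwo.add_self_eq_zero _
      · intro π hπ hne hinv
        apply hne
        have hπ1 : π ≠ 1 := Finset.ne_of_mem_erase hπ
        have : ∃ v, π v ≠ v := by
          by_contra hall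
          push Not at hall
          exact hπ1 (Equiv.ext hall)
        obtain ⟨v, hv⟩ := this
        have hv2 : ∀ u, π (π u) = u := fun u => by
          have h := Equiv.congr_fun hinv (π u)
          exact h.symm.trans (π.symm_apply_apply u)
        have hvv := hv2 v
        apply sum_fibre_zero _ v
        intro σ
        have key : ∀ a, ∏ u, M (Function.update σ v a) u (π u)
            = M (Function.update σ v a) v (π v) *
              ∏ u ∈ (Finset.univ.erase v).erase (π v), M σ u (π u) := by
          intro a
          rw [← Finset.mul_prod_erase _ _ (Finset.mem_univ v),
            ← Finset.mul_prod_erase _ _ (show π v ∈ Finset.univ.erase v by simp [hv]), ← mul_assoc]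
          congr 1
          · rw [hvv, hsymm _ (π v) v]
            generalize M (Function.update σ v a) v (π v) = z
            revert z; decide
          · apply Finset.prod_congr rfl
            intro u hu
            simp only [Finset.mem_erase, Finset.mem_univ, and_true] at hu
            refine hdep _ _ _ _ _ hu.2.symm ?_
            intro h
            apply hu.1
            rw [h, hv2]
        simp only [key]
        rw [← Finset.sum_mul, hsum σ v (π v) hv.symm, zero_mul]
      · intro π _; simp
      · intro π hπ
        simp only [Finset.mem_erase, Finset.mem_univ, and_true, ne_eq] at hπ ⊢
        exact fun h => hπ (inv_eq_one.mp h)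
    rw [e1, e2, add_zero]
  rw [h1, h3, h4] at hz
  exact one_ne_zero hz

section EdgeCol
variable {V : Type*} [Fintype V]

/-- proper edge colouring with three colours -/
def PC (H : SimpleGraph V) (c : Sym2 V → Fin 3) : Prop :=
  ∀ v w x, H.Adj v w → H.Adj v x → c s(v, w) = c s(v, x) → w = x

/-- colours seen at a vertex -/
noncomputable def seen (H : SimpleGraph V) (c : Sym2 V → Fin 3) (v : V) : Finset (Fin 3) :=
  (H.neighborFinset v).image (fun w => c s(v, w))

lemma mem_seen {H : SimpleGraph V} {c : Sym2 V → Fin 3} {v : V} {k : Fin 3} :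
    k ∈ seen H c v ↔ ∃ w, H.Adj v w ∧ c s(v, w) = k := by
  simp [seen]

lemma card_seen {H : SimpleGraph V} {c : Sym2 V → Fin 3} (h : PC H c) (v : V)
    [Fintype (H.neighborSet v)] :
    (seen H c v).card = H.degree v := by
  rw [seen, Finset.card_image_of_injOn]
  · rw [← SimpleGraph.card_neighborFinset_eq_degree]
    congr 1
    ext w
    simp
  · intro w hw w' hw' e
    simp only [SimpleGraph.coe_neighborFinset, SimpleGraph.mem_neighborSet] at hw hw'
    exact h v w w' hw hw' e

lemma seen_parity {H : SimpleGraph V} {c : Sym2 V → Fin 3} (h : PC H c) (k : Fin 3) :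
    Even (Finset.univ.filter (fun v => k ∈ seen H c v)).card := by
  let K : SimpleGraph V :=
    { Adj := fun v w => H.Adj v w ∧ c s(v, w) = k
      symm := ⟨fun v w hh => ⟨hh.1.symm, by rw [Sym2.eq_swap]; exact hh.2⟩⟩
      loopless := ⟨fun v hh => H.loopless.irrefl v hh.1⟩ }
  have hs := K.sum_degrees_eq_twice_card_edges
  have hd : ∀ v, K.degree v = if k ∈ seen H c v then 1 else 0 := by
    intro v
    split_ifs with hk
    · obtain ⟨w, hw, hc⟩ := mem_seen.mp hk
      rw [← SimpleGraph.card_neighborFinset_eq_degree, Finset.card_eq_one]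
      refine ⟨w, ?_⟩
      ext w'
      simp only [SimpleGraph.mem_neighborFinset, Finset.mem_singleton]
      constructor
      · rintro ⟨h1, h2⟩
        exact h v w' w h1 hw (h2.trans hc.symm)
      · rintro rfl; exact ⟨hw, hc⟩
    · rw [← SimpleGraph.card_neighborFinset_eq_degree, Finset.card_eq_zero,
        Finset.eq_empty_iff_forall_notMem]
      intro w hw
      rw [SimpleGraph.mem_neighborFinset] at hw
      exact hk (mem_seen.mpr ⟨w, hw⟩)
  simp only [hd] at hs
  rw [Finset.card_filter, hs]
  exact even_two_mul _

lemma del_neighbor {H : SimpleGraph V} {x y : V} (hxy : H.Adj x y)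
    [Fintype (H.neighborSet x)] [Fintype ((H.deleteEdges {s(x, y)}).neighborSet x)] :
    (H.deleteEdges {s(x, y)}).neighborFinset x = (H.neighborFinset x).erase y := by
  ext w
  simp only [SimpleGraph.mem_neighborFinset, SimpleGraph.deleteEdges_adj, Finset.mem_erase,
    Set.mem_singleton_iff, Sym2.eq_iff]
  have := hxy.ne
  grind

lemma del_degree_left {H : SimpleGraph V} {x y : V} (hxy : H.Adj x y)
    [Fintype (H.neighborSet x)] [Fintype ((H.deleteEdges {s(x, y)}).neighborSet x)] :
    (H.deleteEdges {s(x, y)}).degree x + 1 = H.degree x := by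
  rw [← SimpleGraph.card_neighborFinset_eq_degree, del_neighbor hxy,
    ← SimpleGraph.card_neighborFinset_eq_degree]
  exact Finset.card_erase_add_one (by simpa using hxy)

lemma del_degree_right {H : SimpleGraph V} {x y : V} (hxy : H.Adj x y)
    [Fintype (H.neighborSet y)] [i2 : Fintype ((H.deleteEdges {s(x, y)}).neighborSet y)] :
    (H.deleteEdges {s(x, y)}).degree y + 1 = H.degree y := by
  have h : ∀ e : Sym2 V, e = s(y, x) → ∀ [Fintype ((H.deleteEdges {e}).neighborSet y)],
      (H.deleteEdges {e}).degree y + 1 = H.degree y := by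
    rintro e rfl _
    exact del_degree_left hxy.symm
  exact h _ Sym2.eq_swap

lemma del_degree_other {H : SimpleGraph V} {x y v : V} (hx : v ≠ x) (hy : v ≠ y)
    [Fintype (H.neighborSet v)] [Fintype ((H.deleteEdges {s(x, y)}).neighborSet v)] :
    (H.deleteEdges {s(x, y)}).degree v = H.degree v := by
  rw [← SimpleGraph.card_neighborFinset_eq_degree, ← SimpleGraph.card_neighborFinset_eq_degree]
  congr 1
  ext w
  simp only [SimpleGraph.mem_neighborFinset, SimpleGraph.deleteEdges_adj,
    Set.mem_singleton_iff, Sym2.eq_iff]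
  grind

/-- extend a colouring to a deleted edge -/
lemma extend_col {H : SimpleGraph V} {x y : V} {c : Sym2 V → Fin 3}
    (hc : PC (H.deleteEdges {s(x, y)}) c) (k : Fin 3)
    (hx : k ∉ seen (H.deleteEdges {s(x, y)}) c x) (hy : k ∉ seen (H.deleteEdges {s(x, y)}) c y) :
    PC H (Function.update c s(x, y) k) := by
  have hx' : ∀ w, H.Adj x w → s(x, w) ≠ s(x, y) → c s(x, w) ≠ k := by
    intro w hw hne e
    exact hx (mem_seen.mpr ⟨w, by simp [SimpleGraph.deleteEdges_adj, hw]; simpa using hne, e⟩)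
  have hy' : ∀ w, H.Adj y w → s(y, w) ≠ s(x, y) → c s(y, w) ≠ k := by
    intro w hw hne e
    exact hy (mem_seen.mpr ⟨w, by rw [SimpleGraph.deleteEdges_adj]; exact ⟨hw, hne⟩, e⟩)
  intro v w w' hw hw' he
  by_cases h1 : s(v, w) = s(x, y) <;> by_cases h2 : s(v, w') = s(x, y)
  · have := h1.trans h2.symm
    rcases Sym2.eq_iff.mp this with ⟨_, h⟩ | ⟨h, h'⟩
    · exact h
    · exact h'.trans h
  · rw [h1, Function.update_self, Function.update_of_ne h2] at he
    rcases Sym2.eq_iff.mp h1 with ⟨rfl, rfl⟩ | ⟨rfl, rfl⟩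
    · exact absurd he.symm (hx' _ hw' h2)
    · exact absurd he.symm (hy' _ hw' h2)
  · rw [h2, Function.update_self, Function.update_of_ne h1] at he
    rcases Sym2.eq_iff.mp h2 with ⟨rfl, rfl⟩ | ⟨rfl, rfl⟩
    · exact absurd he (hx' _ hw h1)
    · exact absurd he (hy' _ hw h1)
  · rw [Function.update_of_ne h1, Function.update_of_ne h2] at he
    exact hc v w w' (by rw [SimpleGraph.deleteEdges_adj]; exact ⟨hw, h1⟩)
      (by rw [SimpleGraph.deleteEdges_adj]; exact ⟨hw', h2⟩) he

/-- Kempe swap: given colours `a b` and a set of vertices closed under `a`/`b` edges. -/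
lemma kempe {H : SimpleGraph V} {c : Sym2 V → Fin 3} (hc : PC H c) (a b : Fin 3)
    (S : Set V) (hS : ∀ v w, H.Adj v w → (c s(v, w) = a ∨ c s(v, w) = b) → (v ∈ S ↔ w ∈ S)) :
    ∃ c', PC H c' ∧
      (∀ v ∈ S, ∀ w, H.Adj v w → c' s(v, w) = Equiv.swap a b (c s(v, w))) ∧
      (∀ v ∉ S, ∀ w, H.Adj v w → c' s(v, w) = c s(v, w)) := by
  let c' : Sym2 V → Fin 3 := fun e => if ∃ v ∈ e, v ∈ S then Equiv.swap a b (c e) else c e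
  have h1 : ∀ v ∈ S, ∀ w, H.Adj v w → c' s(v, w) = Equiv.swap a b (c s(v, w)) := by
    intro v hv w _
    have : ∃ u ∈ s(v, w), u ∈ S := ⟨v, by simp, hv⟩
    simp only [c', if_pos this]
  have h2 : ∀ v ∉ S, ∀ w, H.Adj v w → c' s(v, w) = c s(v, w) := by
    intro v hv w hw
    simp only [c']
    split_ifs with h
    · obtain ⟨u, hu, huS⟩ := h
      have huw : u = w := by
        rcases Sym2.mem_iff.mp hu with rfl | rfl
        · exact absurd huS hv
        · rfl
      subst huw
      have hn : ¬ (c s(v, u) = a ∨ c s(v, u) = b) := fun hh => hv ((hS v u hw hh).mpr huS)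
      push Not at hn
      exact Equiv.swap_apply_of_ne_of_ne hn.1 hn.2
    · rfl
  refine ⟨c', ?_, h1, h2⟩
  intro v w w' hw hw' he
  by_cases hv : v ∈ S
  · rw [h1 v hv w hw, h1 v hv w' hw'] at he
    exact hc v w w' hw hw' ((Equiv.swap a b).injective he)
  · rw [h2 v hv w hw, h2 v hv w' hw'] at he
    exact hc _ _ _ hw hw' (by exact he)

/-- A component of a graph with maximum degree two has at most two vertices of degree ≤ 1. -/
lemma three_ends {K : SimpleGraph V} (hK : ∀ v, K.degree v ≤ 2) {x y z : V}
    (hxy : x ≠ y) (hxz : x ≠ z) (hyz : y ≠ z) (dx : K.degree x ≤ 1) (dy : K.degree y ≤ 1)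
    (dz : K.degree z ≤ 1) (rxy : K.Reachable x y) (rxz : K.Reachable x z) : False := by
  let Q := K.connectedComponentMk x
  have hcon := Q.connected_toSimpleGraph
  have h1 := hcon.card_vert_le_card_edgeSet_add_one
  have h2 := Q.toSimpleGraph.sum_degrees_eq_twice_card_edges
  rw [Nat.card_eq_fintype_card, Nat.card_eq_fintype_card, ← SimpleGraph.edgeFinset_card] at h1
  have hd : ∀ v : Q, Q.toSimpleGraph.degree v ≤ K.degree v := by
    intro v
    rw [← SimpleGraph.card_neighborFinset_eq_degree, ← SimpleGraph.card_neighborFinset_eq_degree]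
    apply Finset.card_le_card_of_injOn (fun w : Q => (w : V))
    · intro w hw
      simp only [SimpleGraph.coe_neighborFinset, SimpleGraph.mem_neighborSet] at hw ⊢
      exact hw
    · intro a _ b _ h; exact Subtype.ext h
  let X : Q := ⟨x, rfl⟩
  let Y : Q := ⟨y, SimpleGraph.ConnectedComponent.sound rxy.symm⟩
  let Z : Q := ⟨z, SimpleGraph.ConnectedComponent.sound rxz.symm⟩
  have hXY : X ≠ Y := fun h => hxy (congrArg Subtype.val h)
  have hXZ : X ≠ Z := fun h => hxz (congrArg Subtype.val h)
  have hYZ : Y ≠ Z := fun h => hyz (congrArg Subtype.val h)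
  have h3 : ∑ v : Q, (Q.toSimpleGraph.degree v + if v ∈ ({X, Y, Z} : Finset Q) then 1 else 0)
      ≤ ∑ v : Q, 2 := by
    apply Finset.sum_le_sum
    intro v _
    have hb := hd v
    split_ifs with hv
    · simp only [Finset.mem_insert, Finset.mem_singleton] at hv
      rcases hv with rfl | rfl | rfl
      · exact Nat.add_le_add_right (hb.trans dx) 1
      · exact Nat.add_le_add_right (hb.trans dy) 1
      · exact Nat.add_le_add_right (hb.trans dz) 1
    · exact hb.trans (hK v)
  rw [Finset.sum_add_distrib, h2, ← Finset.card_filter] at h3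
  have h4 : (Finset.univ.filter (fun v => v ∈ ({X, Y, Z} : Finset Q))).card = 3 := by
    rw [Finset.filter_mem_eq_inter, Finset.univ_inter]
    rw [Finset.card_eq_three]
    exact ⟨X, Y, Z, hXY, hXZ, hYZ, rfl⟩
  rw [h4] at h3
  simp only [Finset.sum_const, Finset.card_univ, smul_eq_mul] at h3
  omega


lemma col_arith (b : Fin 3) (P U W : Finset (Fin 3)) (hP : P.card = 2) (hU : U.card = 1)
    (hW : W.card = 2) (hb : b ∈ P) (hbW : b ∈ W) (h : ∀ k, k ∈ P ∨ k ∈ U) :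
    b ∉ U ∧ ∃ a g, a ∉ P ∧ g ∉ U ∧ (a ∉ W ∨ g ∉ W) := by
  obtain ⟨z, rfl⟩ := Finset.card_eq_one.mp hU
  have hz : z ∉ P := by
    intro hz
    have : P = Finset.univ := by
      ext k
      simp only [Finset.mem_univ, iff_true]
      rcases h k with h | h
      · exact h
      · rw [Finset.mem_singleton.mp h]; exact hz
    rw [this] at hP
    simp at hP
  have hbz : b ≠ z := fun e => hz (e ▸ hb)
  refine ⟨by simpa using hbz, z, ?_⟩
  obtain ⟨m, hm⟩ : ∃ m, m ∉ W := by
    by_contra hcon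
    push Not at hcon
    have : W = Finset.univ := by ext k; simp [hcon k]
    rw [this] at hW
    simp at hW
  by_cases hmz : m = z
  · exact ⟨b, hz, by simpa using hbz, Or.inl (hmz ▸ hm)⟩
  · exact ⟨m, hz, by simpa using hmz, Or.inr hm⟩

lemma recolour {H : SimpleGraph V} {p u u' : V} {c : Sym2 V → Fin 3} {a : Fin 3}
    (hu : u ≠ u') (hpu : H.Adj p u) (hpu' : H.Adj p u')
    (hc : PC (H.deleteEdges {s(p, u)}) c)
    (h1 : a ∉ seen (H.deleteEdges {s(p, u)}) c p) (h2 : a ∉ seen (H.deleteEdges {s(p, u)}) c u')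
    (h3 : c s(p, u') ∉ seen (H.deleteEdges {s(p, u)}) c u) : ∃ c', PC H c' := by
  have hadj : (H.deleteEdges {s(p, u)}).Adj p u' := by
    rw [SimpleGraph.deleteEdges_adj]
    refine ⟨hpu', ?_⟩
    simp only [Set.mem_singleton_iff, Sym2.eq_iff]
    have := hpu.ne
    grind
  have hab : c s(p, u') ≠ a := fun h => h1 (mem_seen.mpr ⟨u', hadj, h⟩)
  generalize hH0 : H.deleteEdges {s(p, u)} = H0 at *
  have hmono : ∀ v w, (H0.deleteEdges {s(p, u')}).Adj v w → H0.Adj v w := fun v w h =>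
    ((SimpleGraph.deleteEdges_adj).mp h).1
  have hc0 : PC (H0.deleteEdges {s(p, u')}) c := fun v w w' hw hw' e =>
    hc v w w' (hmono _ _ hw) (hmono _ _ hw') e
  have hc1 : PC H0 (Function.update c s(p, u') a) := by
    apply extend_col hc0
    · intro h
      obtain ⟨w, hw, e⟩ := mem_seen.mp h
      exact h1 (mem_seen.mpr ⟨w, hmono _ _ hw, e⟩)
    · intro h
      obtain ⟨w, hw, e⟩ := mem_seen.mp h
      exact h2 (mem_seen.mpr ⟨w, hmono _ _ hw, e⟩)
  subst hH0
  refine ⟨_, extend_col hc1 (c s(p, u')) ?_ ?_⟩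
  · intro h
    obtain ⟨w, hw, e⟩ := mem_seen.mp h
    by_cases hwu : s(p, w) = s(p, u')
    · rw [hwu, Function.update_self] at e
      exact hab e.symm
    · rw [Function.update_of_ne hwu] at e
      exact hwu (by rw [hc p w u' hw hadj e])
  · intro h
    obtain ⟨w, hw, e⟩ := mem_seen.mp h
    have : s(u, w) ≠ s(p, u') := by
      intro h
      rcases Sym2.eq_iff.mp h with ⟨h, _⟩ | ⟨h, _⟩
      · exact hpu.ne h.symm
      · exact hu h
    rw [Function.update_of_ne this] at e
    exact h3 (mem_seen.mpr ⟨w, hw, e⟩)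

lemma common_nbr {H : SimpleGraph V} (hno : ¬ ∃ c, PC H c) {p u u' : V} (hu : u ≠ u')
    (hpu : H.Adj p u) (hpu' : H.Adj p u') (dp : H.degree p = 3) (du : H.degree u = 2)
    (du' : H.degree u' = 2) {c : Sym2 V → Fin 3} (hc : PC (H.deleteEdges {s(p, u)}) c) :
    False := by
  have cp : (seen (H.deleteEdges {s(p, u)}) c p).card = 2 := by
    have := del_degree_left hpu; rw [card_seen hc]; omega
  have cu : (seen (H.deleteEdges {s(p, u)}) c u).card = 1 := by
    have := del_degree_right hpu; rw [card_seen hc]; omega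
  have cu' : (seen (H.deleteEdges {s(p, u)}) c u').card = 2 := by
    rw [card_seen hc, del_degree_other hpu'.ne' hu.symm, du']
  have hadj : (H.deleteEdges {s(p, u)}).Adj p u' := by
    rw [SimpleGraph.deleteEdges_adj]
    refine ⟨hpu', ?_⟩
    simp only [Set.mem_singleton_iff, Sym2.eq_iff]
    have := hpu.ne
    grind
  have bp : c s(p, u') ∈ seen (H.deleteEdges {s(p, u)}) c p := mem_seen.mpr ⟨_, hadj, rfl⟩
  have bu' : c s(p, u') ∈ seen (H.deleteEdges {s(p, u)}) c u' :=
    mem_seen.mpr ⟨_, hadj.symm, by rw [Sym2.eq_swap]⟩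
  have hun : ∀ k, k ∈ seen (H.deleteEdges {s(p, u)}) c p ∨
      k ∈ seen (H.deleteEdges {s(p, u)}) c u := by
    intro k
    by_contra hk
    push Not at hk
    exact hno ⟨_, extend_col hc k hk.1 hk.2⟩
  obtain ⟨bu, a, g, ap, gu, hag⟩ := col_arith _ _ _ _ cp cu cu' bp bu' hun
  by_cases ha' : a ∉ seen (H.deleteEdges {s(p, u)}) c u'
  · exact hno (recolour hu hpu hpu' hc ap ha' bu)
  have gu' := hag.resolve_left ha'
  clear hag ha'
  have hR : ∀ c, PC (H.deleteEdges {s(p, u)}) c → a ∉ seen (H.deleteEdges {s(p, u)}) c p →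
      a ∉ seen (H.deleteEdges {s(p, u)}) c u' → c s(p, u') ∉ seen (H.deleteEdges {s(p, u)}) c u →
      False := fun c h0 h1 h2 h3 => hno (recolour hu hpu hpu' h0 h1 h2 h3)
  have hE : ∀ c, PC (H.deleteEdges {s(p, u)}) c → ∀ k, k ∉ seen (H.deleteEdges {s(p, u)}) c p →
      k ∉ seen (H.deleteEdges {s(p, u)}) c u → False :=
    fun c h0 k h1 h2 => hno ⟨_, extend_col h0 k h1 h2⟩
  generalize H.deleteEdges {s(p, u)} = H0 at *
  obtain ⟨K, hKadj⟩ : ∃ K : SimpleGraph V, ∀ v w, K.Adj v w ↔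
      (H0.Adj v w ∧ (c s(v, w) = a ∨ c s(v, w) = g)) :=
    ⟨{ Adj := fun v w => H0.Adj v w ∧ (c s(v, w) = a ∨ c s(v, w) = g)
       symm := ⟨fun v w hh => ⟨hh.1.symm, by rw [Sym2.eq_swap]; exact hh.2⟩⟩
       loopless := ⟨fun v hh => H0.loopless.irrefl v hh.1⟩ }, fun _ _ => Iff.rfl⟩
  have hd : ∀ v, K.degree v ≤ (({a, g} : Finset (Fin 3)) ∩ seen H0 c v).card := by
    intro v
    rw [← SimpleGraph.card_neighborFinset_eq_degree]
    apply Finset.card_le_card_of_injOn (fun w => c s(v, w))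
    · intro w hw
      simp only [SimpleGraph.coe_neighborFinset, SimpleGraph.mem_neighborSet, hKadj] at hw
      simp only [Finset.coe_inter, Set.mem_inter_iff, Finset.mem_coe, Finset.mem_insert,
        Finset.mem_singleton]
      exact ⟨hw.2, mem_seen.mpr ⟨w, hw.1, rfl⟩⟩
    · intro w hw w' hw' e
      simp only [SimpleGraph.coe_neighborFinset, SimpleGraph.mem_neighborSet, hKadj] at hw hw'
      exact hc v w w' hw.1 hw'.1 e
  have hd2 : ∀ v, K.degree v ≤ 2 := fun v =>
    (hd v).trans ((Finset.card_le_card Finset.inter_subset_left).trans Finset.card_le_two)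
  have hfin : ∀ (a g : Fin 3) (T : Finset (Fin 3)), (a ∉ T ∨ g ∉ T) →
      (({a, g} : Finset (Fin 3)) ∩ T).card ≤ 1 := by decide
  have dp1 : K.degree p ≤ 1 := (hd p).trans (hfin _ _ _ (Or.inl ap))
  have du1 : K.degree u ≤ 1 := (hd u).trans (hfin _ _ _ (Or.inr gu))
  have du1' : K.degree u' ≤ 1 := (hd u').trans (hfin _ _ _ (Or.inr gu'))
  have hnot : ¬ (K.Reachable u' p ∧ K.Reachable u' u) := fun h =>
    three_ends hd2 hpu'.ne' hu.symm hpu.ne du1' dp1 du1 h.1 h.2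
  obtain ⟨c', hc', hin, hout⟩ := kempe hc a g {v | K.Reachable u' v} (by
    intro v w hvw hcol
    have hK : K.Adj v w := (hKadj v w).mpr ⟨hvw, hcol⟩
    exact ⟨fun h => h.trans hK.reachable, fun h => h.trans hK.symm.reachable⟩)
  have seen_out : ∀ v, ¬ K.Reachable u' v → ∀ k, k ∉ seen H0 c v → k ∉ seen H0 c' v := by
    intro v hv k hk h
    obtain ⟨w, hw, e⟩ := mem_seen.mp h
    rw [hout v hv w hw] at e
    exact hk (mem_seen.mpr ⟨w, hw, e⟩)
  have seen_in : ∀ v, K.Reachable u' v → ∀ k, Equiv.swap a g k ∉ seen H0 c v →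
      k ∉ seen H0 c' v := by
    intro v hv k hk h
    obtain ⟨w, hw, e⟩ := mem_seen.mp h
    rw [hin v hv w hw] at e
    exact hk (mem_seen.mpr ⟨w, hw, by rw [← e, Equiv.swap_apply_self]⟩)
  by_cases rp : K.Reachable u' p
  · have ru : ¬ K.Reachable u' u := fun h => hnot ⟨rp, h⟩
    exact hE c' hc' g (seen_in p rp g (by rwa [Equiv.swap_apply_right])) (seen_out u ru g gu)
  · by_cases ru : K.Reachable u' u
    · exact hE c' hc' a (seen_out p rp a ap) (seen_in u ru a (by rwa [Equiv.swap_apply_left]))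
    · refine hR c' hc' (seen_out p rp a ap)
        (seen_in u' (SimpleGraph.Reachable.refl _) a (by rwa [Equiv.swap_apply_left])) ?_
      rw [hout p rp u' hadj]
      exact seen_out u ru _ bu

lemma critical_struct {F : SimpleGraph V} (hF : ∀ v, F.degree v ≤ 3)
    (h8 : (Finset.univ.filter (fun v => 2 ≤ F.degree v)).card ≤ 8)
    (hno : ¬ ∃ c, PC F c) :
    ∃ H ≤ F, ∃ u, H.degree u = 2 ∧ ∀ v, v ≠ u → H.degree v = 0 ∨ H.degree v = 3 := by
  obtain ⟨H, hHF, hmin⟩ := exists_minimal_le_of_wellFoundedLT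
    (fun H : SimpleGraph V => ¬ ∃ c, PC H c) F hno
  have hH : ¬ ∃ c, PC H c := hmin.prop
  have hdel : ∀ x y, H.Adj x y → ∃ c, PC (H.deleteEdges {s(x, y)}) c := by
    intro x y hxy
    by_contra hcon
    have := hmin.le_of_le hcon (SimpleGraph.deleteEdges_le _)
    have h2 := this hxy
    rw [SimpleGraph.deleteEdges_adj] at h2
    exact h2.2 rfl
  have hle : ∀ v, H.degree v ≤ F.degree v := fun v => SimpleGraph.degree_le_of_le hHF
  have hd3 : ∀ v, H.degree v ≤ 3 := fun v => (hle v).trans (hF v)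
  have hunion : ∀ x y (c : Sym2 V → Fin 3), PC (H.deleteEdges {s(x, y)}) c → ∀ k,
      k ∉ seen (H.deleteEdges {s(x, y)}) c x → k ∈ seen (H.deleteEdges {s(x, y)}) c y := by
    intro x y c hc k hk
    by_contra hk2
    exact hH ⟨_, extend_col hc k hk hk2⟩
  have h5 : ∀ x y, H.Adj x y → 5 ≤ H.degree x + H.degree y := by
    intro x y hxy
    obtain ⟨c, hc⟩ := hdel x y hxy
    have h1 := del_degree_left hxy
    have h2 := del_degree_right hxy
    rw [← card_seen hc] at h1 h2
    have h3 := hunion x y c hc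
    have : (Finset.univ : Finset (Fin 3)) ⊆ seen (H.deleteEdges {s(x, y)}) c x ∪
        seen (H.deleteEdges {s(x, y)}) c y := by
      intro k _
      rw [Finset.mem_union]
      by_cases hk : k ∈ seen (H.deleteEdges {s(x, y)}) c x
      · exact Or.inl hk
      · exact Or.inr (h3 k hk)
    have h4 := (Finset.card_le_card this).trans (Finset.card_union_le _ _)
    simp only [Finset.card_univ, Fintype.card_fin] at h4
    omega
  have hadj2 : ∀ x y, H.Adj x y → 2 ≤ H.degree x := by
    intro x y hxy
    have := h5 x y hxy
    have := hd3 y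
    omega
  have hdeg0 : ∀ v, H.degree v = 0 ∨ 2 ≤ H.degree v := by
    intro v
    by_cases h : H.degree v = 0
    · exact Or.inl h
    · obtain ⟨w, hw⟩ := (H.degree_pos_iff_exists_adj v).mp (Nat.pos_of_ne_zero h)
      exact Or.inr (hadj2 v w hw)
  have hcn : ∀ p u u', u ≠ u' → H.Adj p u → H.Adj p u' → H.degree u = 2 → H.degree u' = 2 →
      False := by
    intro p u u' hne h1 h2 d1 d2
    obtain ⟨c, hc⟩ := hdel p u h1
    have := h5 p u h1
    have := hd3 p
    exact common_nbr hH hne h1 h2 (by omega) d1 d2 hc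
  let S := Finset.univ.filter (fun v => 2 ≤ H.degree v)
  let D := Finset.univ.filter (fun v => H.degree v = 2)
  have hS8 : S.card ≤ 8 := by
    refine le_trans (Finset.card_le_card ?_) h8
    intro v hv
    simp only [S, Finset.mem_filter, Finset.mem_univ, true_and] at hv ⊢
    exact hv.trans (hle v)
  have hD2 : D.card ≤ 2 := by
    by_contra hcon
    push Not at hcon
    obtain ⟨x, hx, y, hy, z, hz, hxy, hxz, hyz⟩ := Finset.two_lt_card.mp hcon
    simp only [D, Finset.mem_filter, Finset.mem_univ, true_and] at hx hy hz
    have hcard : ∀ v, H.degree v = 2 → (insert v (H.neighborFinset v)).card = 3 := by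
      intro v hv
      rw [Finset.card_insert_of_notMem (by simp), SimpleGraph.card_neighborFinset_eq_degree, hv]
    have hdisj : ∀ v w, v ≠ w → H.degree v = 2 → H.degree w = 2 →
        Disjoint (insert v (H.neighborFinset v)) (insert w (H.neighborFinset w)) := by
      intro v w hvw hv hw
      rw [Finset.disjoint_left]
      intro a ha hb
      simp only [Finset.mem_insert, SimpleGraph.mem_neighborFinset] at ha hb
      rcases ha with rfl | ha <;> rcases hb with rfl | hb
      · exact hvw rfl
      · have := h5 _ _ hb; omega
      · have := h5 _ _ ha; omega
      · exact hcn a v w hvw ha.symm hb.symm hv hw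
    have hsub : insert x (H.neighborFinset x) ∪ insert y (H.neighborFinset y) ∪
        insert z (H.neighborFinset z) ⊆ S := by
      have : ∀ v, H.degree v = 2 → insert v (H.neighborFinset v) ⊆ S := by
        intro v hv w hw
        simp only [Finset.mem_insert, SimpleGraph.mem_neighborFinset] at hw
        simp only [S, Finset.mem_filter, Finset.mem_univ, true_and]
        rcases hw with rfl | hw
        · omega
        · exact hadj2 _ _ hw.symm
      exact Finset.union_subset (Finset.union_subset (this x hx) (this y hy)) (this z hz)
    have := Finset.card_le_card hsub
    rw [Finset.card_union_of_disjoint, Finset.card_union_of_disjoint (hdisj x y hxy hx hy),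
      hcard x hx, hcard y hy, hcard z hz] at this
    · omega
    · rw [Finset.disjoint_union_left]
      exact ⟨hdisj x z hxz hx hz, hdisj y z hyz hy hz⟩
  have hSD : Even (S.card + D.card) := by
    have h1 := H.sum_degrees_eq_twice_card_edges
    have h2 : ∑ v, H.degree v + ∑ v, (if H.degree v = 2 then 1 else 0)
        = 3 * ∑ v, (if 2 ≤ H.degree v then 1 else 0) := by
      rw [← Finset.sum_add_distrib, Finset.mul_sum]
      refine Finset.sum_congr rfl fun v _ => ?_
      have := hdeg0 v
      have := hd3 v
      split_ifs <;> omega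
    rw [← Finset.card_filter, ← Finset.card_filter] at h2
    change _ + D.card = 3 * S.card at h2
    rw [Nat.even_iff]
    omega
  -- a vertex which is the only one to miss a colour
  have hkey : ∀ x y, H.Adj x y → ∀ c, PC (H.deleteEdges {s(x, y)}) c → ∀ k : Fin 3, ∀ z ∈ S,
      k ∉ seen (H.deleteEdges {s(x, y)}) c z →
      (∀ v ∈ S, v ≠ z → k ∈ seen (H.deleteEdges {s(x, y)}) c v) → D.card = 1 := by
    intro x y hxy c hc k z hz hkz hall
    have h1 := seen_parity hc k
    have : Finset.univ.filter (fun v => k ∈ seen (H.deleteEdges {s(x, y)}) c v) = S.erase z := by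
      ext v
      simp only [Finset.mem_filter, Finset.mem_univ, true_and, Finset.mem_erase]
      constructor
      · intro hv
        refine ⟨fun h => hkz (h ▸ hv), ?_⟩
        obtain ⟨w, hw, _⟩ := mem_seen.mp hv
        rw [SimpleGraph.deleteEdges_adj] at hw
        simp only [S, Finset.mem_filter, Finset.mem_univ, true_and]
        exact hadj2 v w hw.1
      · rintro ⟨h1, h2⟩
        exact hall v h2 h1
    rw [this, Finset.card_erase_of_mem hz] at h1
    have : 0 < S.card := Finset.card_pos.mpr ⟨z, hz⟩
    rw [Nat.even_iff] at *
    omega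
  have hfull : ∀ x y, ∀ c, PC (H.deleteEdges {s(x, y)}) c → ∀ v, v ≠ x → v ≠ y →
      H.degree v = 3 → ∀ k, k ∈ seen (H.deleteEdges {s(x, y)}) c v := by
    intro x y c hc v hx hy hv k
    have : seen (H.deleteEdges {s(x, y)}) c v = Finset.univ := by
      rw [← Finset.card_eq_iff_eq_univ, card_seen hc, del_degree_other hx hy, hv]
      rfl
    rw [this]
    exact Finset.mem_univ k
  have hmemS : ∀ v, v ∈ S ↔ 2 ≤ H.degree v := by
    intro v; simp only [S, Finset.mem_filter, Finset.mem_univ, true_and]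
  have hmemD : ∀ v, v ∈ D ↔ H.degree v = 2 := by
    intro v; simp only [D, Finset.mem_filter, Finset.mem_univ, true_and]
  have hD1 : D.card = 1 := by
    by_cases h0 : D.card = 0
    · have hne : ∃ x y, H.Adj x y := by
        by_contra hcon
        push Not at hcon
        exact hH ⟨fun _ => 0, fun v w _ h => absurd h (hcon v w)⟩
      obtain ⟨x, y, hxy⟩ := hne
      rw [Finset.card_eq_zero] at h0
      have hd : ∀ v, v ∈ S → H.degree v = 3 := by
        intro v hv
        have h1 : v ∉ D := by rw [h0]; simp
        rw [hmemD] at h1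
        rw [hmemS] at hv
        have := hd3 v
        omega
      obtain ⟨c, hc⟩ := hdel x y hxy
      have hxS : x ∈ S := (hmemS x).mpr (hadj2 x y hxy)
      have : ∃ k, k ∉ seen (H.deleteEdges {s(x, y)}) c x := by
        by_contra hcon
        push Not at hcon
        have h1 : seen (H.deleteEdges {s(x, y)}) c x = Finset.univ := by
          ext k; simp [hcon k]
        have h2 := card_seen hc x
        rw [h1] at h2
        simp only [Finset.card_univ, Fintype.card_fin] at h2
        have := del_degree_left hxy
        have := hd3 x
        omega
      obtain ⟨k, hk⟩ := this
      refine hkey x y hxy c hc k x hxS hk ?_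
      intro v hv hvx
      by_cases hvy : v = y
      · rw [hvy]; exact hunion x y c hc k hk
      · exact hfull x y c hc v hvx hvy (hd v hv) k
    · by_cases h2 : D.card = 2
      · obtain ⟨u, v, huv, hDe⟩ := Finset.card_eq_two.mp h2
        have du : H.degree u = 2 := (hmemD u).mp (by rw [hDe]; simp)
        have dv : H.degree v = 2 := (hmemD v).mp (by rw [hDe]; simp)
        obtain ⟨p, hp⟩ := (H.degree_pos_iff_exists_adj u).mp (by omega)
        have dp : H.degree p = 3 := by
          have := h5 u p hp
          have := hd3 p
          omega
        obtain ⟨c, hc⟩ := hdel u p hp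
        have cu : (seen (H.deleteEdges {s(u, p)}) c u).card = 1 := by
          have := del_degree_left hp
          rw [card_seen hc]; omega
        have hvp : v ≠ p := by rintro rfl; omega
        have cv : (seen (H.deleteEdges {s(u, p)}) c v).card = 2 := by
          rw [card_seen hc, del_degree_other huv.symm hvp, dv]
        have hex : ∀ U W : Finset (Fin 3), U.card = 1 → W.card = 2 → ∃ k, k ∉ U ∧ k ∈ W := by
          decide
        obtain ⟨k, hk1, hk2⟩ := hex _ _ cu cv
        refine hkey u p hp c hc k u ((hmemS u).mpr (by omega)) hk1 ?_
        intro w hw hwu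
        by_cases hwp : w = p
        · rw [hwp]; exact hunion u p c hc k hk1
        · by_cases hwv : w = v
          · rw [hwv]; exact hk2
          · apply hfull u p c hc w hwu hwp
            have h1 : w ∉ D := by rw [hDe]; simp [hwu, hwv]
            rw [hmemD] at h1
            rw [hmemS] at hw
            have := hd3 w
            omega
      · omega
  obtain ⟨u, hu⟩ := Finset.card_eq_one.mp hD1
  refine ⟨H, hHF, u, (hmemD u).mp (by rw [hu]; simp), ?_⟩
  intro v hv
  have h1 : v ∉ D := by rw [hu]; simpa using hv
  rw [hmemD] at h1
  have := hdeg0 v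
  have := hd3 v
  omega

/-- In a bridgeless cubic graph small cores are 3-edge-colourable. -/
lemma exists_colouring {G F : SimpleGraph V} (hG : ∀ v, G.degree v = 3)
    (hb : ∀ e, ¬ G.IsBridge e) (hF : F ≤ G)
    (h8 : (Finset.univ.filter (fun v => 2 ≤ F.degree v)).card ≤ 8) : ∃ c, PC F c := by
  by_contra hno
  obtain ⟨H, hHF, u, du, hrest⟩ := critical_struct (fun v => by
    rw [← hG v]; exact SimpleGraph.degree_le_of_le hF) h8 hno
  have hHG : H ≤ G := hHF.trans hF
  have hsub : H.neighborFinset u ⊆ G.neighborFinset u := by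
    intro w hw
    rw [SimpleGraph.mem_neighborFinset] at hw ⊢
    exact hHG hw
  have : ∃ z, G.Adj u z ∧ ¬ H.Adj u z := by
    by_contra hcon
    push Not at hcon
    have h2 : G.neighborFinset u ⊆ H.neighborFinset u := by
      intro w hw
      rw [SimpleGraph.mem_neighborFinset] at hw ⊢
      exact hcon w hw
    have h3 := Finset.card_le_card h2
    rw [SimpleGraph.card_neighborFinset_eq_degree, SimpleGraph.card_neighborFinset_eq_degree,
      hG, du] at h3
    omega
  obtain ⟨z, hz, hzH⟩ := this
  have huniq : ∀ w, G.Adj u w → w ≠ z → H.Adj u w := by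
    intro w hw hwz
    have h1 : insert z (H.neighborFinset u) = G.neighborFinset u := by
      apply Finset.eq_of_subset_of_card_le
      · intro a ha
        rw [Finset.mem_insert] at ha
        rcases ha with rfl | ha
        · rwa [SimpleGraph.mem_neighborFinset]
        · exact hsub ha
      · rw [Finset.card_insert_of_notMem (by rwa [SimpleGraph.mem_neighborFinset]),
          SimpleGraph.card_neighborFinset_eq_degree, SimpleGraph.card_neighborFinset_eq_degree,
          hG, du]
    have h2 : w ∈ insert z (H.neighborFinset u) := by
      rw [h1]; rwa [SimpleGraph.mem_neighborFinset]
    rw [Finset.mem_insert] at h2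
    simpa using h2.resolve_left hwz
  have hfull : ∀ v, H.degree v = 3 → ∀ w, G.Adj v w → H.Adj v w := by
    intro v hv w hw
    have h1 : H.neighborFinset v = G.neighborFinset v := by
      apply Finset.eq_of_subset_of_card_le
      · intro a ha
        rw [SimpleGraph.mem_neighborFinset] at ha ⊢
        exact hHG ha
      · rw [SimpleGraph.card_neighborFinset_eq_degree, SimpleGraph.card_neighborFinset_eq_degree,
          hG, hv]
    have h2 : w ∈ H.neighborFinset v := by rw [h1]; rwa [SimpleGraph.mem_neighborFinset]
    simpa using h2
  have hpos : ∀ v w, H.Adj v w → H.degree w ≠ 0 := by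
    intro v w h
    have := (H.degree_pos_iff_exists_adj w).mpr ⟨v, h.symm⟩
    omega
  have hz0 : H.degree z = 0 := by
    rcases hrest z hz.ne' with h | h
    · exact h
    · exact absurd (hfull z h u hz.symm).symm hzH
  apply hb s(u, z)
  rw [SimpleGraph.isBridge_iff]
  rintro ⟨w⟩
  have hclosed : ∀ a b : V, (G.deleteEdges {s(u, z)}).Walk a b → H.degree a ≠ 0 →
      H.degree b ≠ 0 := by
    intro a b p
    induction p with
    | nil => exact id
    | cons h p ih =>
      rename_i x y _
      intro hx
      apply ih
      rw [SimpleGraph.deleteEdges_adj] at h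
      by_cases hxu : x = u
      · subst hxu
        refine hpos x y (huniq y h.1 ?_)
        rintro rfl
        exact h.2 rfl
      · rcases hrest x hxu with h0 | h3
        · exact absurd h0 hx
        · exact hpos x y (hfull x h3 y h.1)
  exact hclosed u z w (by omega) hz0

end EdgeCol

section Flow
variable {V : Type*} [Fintype V]

lemma symm_sum {A : Type*} [AddCommGroup A] (h2 : ∀ a : A, a + a = 0) (f : V → V → A)
    (hs : ∀ v w, f v w = f w v) (h0 : ∀ v, f v v = 0) : ∑ v, ∑ w, f v w = 0 := by
  rw [← Finset.sum_product']
  refine Finset.sum_involution (fun p _ => (p.2, p.1)) ?_ ?_ ?_ ?_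
  · intro p _
    simp only
    rw [hs p.2 p.1]
    exact h2 _
  · rintro ⟨a, b⟩ _ hne heq
    simp only [Prod.mk.injEq] at heq
    apply hne
    rw [heq.1]
    exact h0 _
  · intro p _; simp
  · intro p _; rfl

lemma edge_bd {x y : V} (hxy : x ≠ y) (v : V) :
    ∑ w, (if s(v, w) = s(x, y) then (1 : ZMod 2) else 0) =
      (if v = x then 1 else 0) + (if v = y then 1 else 0) := by
  by_cases hx : v = x
  · subst hx
    have : ∀ w, (s(v, w) = s(v, y)) ↔ (w = y) := by
      intro w; rw [Sym2.eq_iff]; grind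
    simp [this, hxy]
  · by_cases hy : v = y
    · subst hy
      have : ∀ w, (s(v, w) = s(x, v)) ↔ (w = x) := by
        intro w; rw [Sym2.eq_iff]; grind
      simp [this, hx]
    · have : ∀ w, ¬ (s(v, w) = s(x, y)) := by
        intro w; rw [Sym2.eq_iff]; grind
      simp [this, hx, hy]

lemma walk_fn {H : SimpleGraph V} {a b : V} (p : H.Walk a b) :
    ∃ f : Sym2 V → ZMod 2, (∀ e, e ∉ H.edgeSet → f e = 0) ∧
      ∀ v, ∑ w, f s(v, w) = (if v = a then 1 else 0) + (if v = b then 1 else 0) := by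
  induction p with
  | nil => exact ⟨fun _ => 0, by simp, fun v => by simp [CharTwo.add_self_eq_zero]⟩
  | cons h p ih =>
    rename_i x y z
    obtain ⟨f, hf0, hf⟩ := ih
    refine ⟨fun e => f e + if e = s(x, y) then 1 else 0, ?_, ?_⟩
    · intro e he
      have : e ≠ s(x, y) := by
        rintro rfl
        exact he h
      simp [hf0 e he, this]
    · intro v
      rw [Finset.sum_add_distrib, hf, edge_bd h.ne]
      have := CharTwo.add_self_eq_zero (if v = y then (1 : ZMod 2) else 0)
      linear_combination this

lemma exists_flow {A : Type*} [AddCommGroup A] [Module (ZMod 2) A] (H : SimpleGraph V)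
    (r : V → V) (hr : ∀ v, H.Reachable v (r v)) (d : V → A)
    (hd : ∀ u, ∑ v, (if r v = u then d v else 0) = 0) :
    ∃ f : Sym2 V → A, (∀ e, e ∉ H.edgeSet → f e = 0) ∧ ∀ v, ∑ w, f s(v, w) = d v := by
  choose f hf0 hf using fun v => walk_fn (hr v).some
  refine ⟨fun e => ∑ v, f v e • d v, ?_, ?_⟩
  · intro e he
    apply Finset.sum_eq_zero
    intro v _
    rw [hf0 v e he, zero_smul]
  · intro u
    rw [Finset.sum_comm]
    have : ∀ v, ∑ w, f v s(u, w) • d v = (if v = u then d v else 0) + if r v = u then d v else 0 := by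
      intro v
      rw [← Finset.sum_smul, hf, add_smul]
      congr 1
      · by_cases h : v = u
        · simp [h]
        · simp [h, Ne.symm h]
      · by_cases h : r v = u
        · simp [h]
        · simp [h, Ne.symm h]
    simp only [this]
    rw [Finset.sum_add_distrib, hd]
    simp

abbrev L := ZMod 2 × ZMod 2

def om (x y : L) : ZMod 2 := x.1 * y.2 + x.2 * y.1
def nz (x : L) : ZMod 2 := x.1 + x.2 + x.1 * x.2
def rt (a : Fin 3) (x : L) : L :=
  if a = 0 then x else if a = 1 then (x.2, x.1 + x.2) else (x.1 + x.2, x.1)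

lemma L_two (x : L) : x + x = 0 := by revert x; decide
lemma om_add (x y z : L) : om x (y + z) = om x y + om x z := by revert x y z; decide
lemma om_symm (x y : L) : om x y = om y x := by revert x y; decide
lemma om_zero (x : L) : om x 0 = 0 := by revert x; decide
lemma rt_add (a : Fin 3) (x y : L) : rt a (x + y) = rt a x + rt a y := by revert a x y; decide
lemma rt_ne (a : Fin 3) (x : L) (hx : x ≠ 0) : rt a x ≠ 0 := by revert a x; decide
lemma rt_zero (a : Fin 3) : rt a 0 = 0 := by revert a; decide
lemma rt_sum (x y : L) : ∑ a, om (rt a x) y = 0 := by revert x y; decide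
lemma nz_add (x y : L) : nz (x + y) = nz x + nz y + om x y := by revert x y; decide
lemma nz_eq (x : L) : nz x = if x = 0 then 0 else 1 := by revert x; decide

lemma om_finsum {ι : Type*} (s : Finset ι) (x : L) (f : ι → L) :
    om x (∑ i ∈ s, f i) = ∑ i ∈ s, om x (f i) :=
  map_sum (AddMonoidHom.mk' (om x) (om_add x)) f s
lemma rt_finsum {ι : Type*} (s : Finset ι) (a : Fin 3) (f : ι → L) :
    rt a (∑ i ∈ s, f i) = ∑ i ∈ s, rt a (f i) :=
  map_sum (AddMonoidHom.mk' (rt a) (rt_add a)) f s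

/-- every vertex has degree zero or two -/
def Deg02 (P : SimpleGraph V) : Prop :=
  ∀ v, (∃ a b, a ≠ b ∧ ∀ w, P.Adj v w ↔ w = a ∨ w = b) ∨ (∀ w, ¬ P.Adj v w)

lemma loc {A : Type*} [AddCommGroup A] (h2 : ∀ a : A, a + a = 0) {P : SimpleGraph V}
    (hP : Deg02 P) (r : Sym2 V → A) (hr : ∀ e, e ∉ P.edgeSet → r e = 0) (v : V)
    (hv : ∑ w, r s(v, w) = 0) (h : A → ZMod 2) :
    ∑ w, (if P.Adj v w then h (r s(v, w)) else 0) = 0 := by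
  rcases hP v with ⟨a, b, hab, hw⟩ | hw
  · have key : ∀ {B : Type _} [AddCommGroup B] (g : V → B),
        ∑ w, (if P.Adj v w then g w else 0) = g a + g b := by
      intro B _ g
      rw [← Finset.sum_filter]
      have : Finset.univ.filter (fun w => P.Adj v w) = {a, b} := by
        ext w; simp [hw]
      rw [this, Finset.sum_pair hab]
    have h1 : ∑ w, r s(v, w) = ∑ w, (if P.Adj v w then r s(v, w) else 0) := by
      refine Finset.sum_congr rfl fun w _ => ?_
      split_ifs with hh
      · rfl
      · exact hr _ hh
    rw [h1, key] at hv
    have h3 : r s(v, a) = r s(v, b) := by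
      have := h2 (r s(v, b))
      exact (eq_neg_of_add_eq_zero_left hv).trans (eq_neg_of_add_eq_zero_left this).symm
    have key2 : ∑ w, (if P.Adj v w then h (r s(v, w)) else 0) = h (r s(v, a)) + h (r s(v, b)) := by
      rw [← Finset.sum_filter]
      have : Finset.univ.filter (fun w => P.Adj v w) = {a, b} := by
        ext w; simp [hw]
      rw [this, Finset.sum_pair hab]
    rw [key2, h3, CharTwo.add_self_eq_zero]
  · simp [hw]

lemma exists_psi {P F : SimpleGraph V} (hP : Deg02 P)
    (hconn : ∀ u v, (∃ w, P.Adj u w) → (∃ w, P.Adj v w) → P.Reachable u v)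
    (hPF : ∀ v w, P.Adj v w → ¬ F.Adj v w)
    (cp : V → V) (hcp : ∀ v w, F.Adj v w → cp v = cp w)
    (l : Sym2 V → L) (hl0 : ∀ e, e ∉ F.edgeSet → l e = 0) (hl1 : ∀ e ∈ F.edgeSet, l e ≠ 0)
    (hl : ∀ v, (∀ w, ¬ P.Adj v w) → ∑ w, l s(v, w) = 0) :
    ∃ ψ : Sym2 V → L, (∀ e, e ∉ P.edgeSet → e ∉ F.edgeSet → ψ e = 0) ∧
      (∀ e ∈ F.edgeSet, ψ e ≠ 0) ∧ (∀ v, ∑ w, ψ s(v, w) = 0) ∧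
      ∀ K : V, ∑ v, (if cp v = K then ∑ w, (if P.Adj v w then nz (ψ s(v, w)) else 0) else 0) = 0 := by
  -- labels restricted to a component
  let lK : V → Sym2 V → L := fun K e => if ∃ v ∈ e, cp v = K then l e else 0
  have hl' : ∀ v w, ¬ F.Adj v w → l s(v, w) = 0 := fun v w h => hl0 _ h
  have hlK : ∀ K v w, lK K s(v, w) = if cp v = K then l s(v, w) else 0 := by
    intro K v w
    by_cases hF : F.Adj v w
    · have h1 := hcp v w hF
      have : (∃ u ∈ s(v, w), cp u = K) ↔ cp v = K := by
        constructor
        · rintro ⟨u, hu, rfl⟩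
          rcases Sym2.mem_iff.mp hu with rfl | rfl
          · rfl
          · exact h1
        · intro h
          exact ⟨v, by simp, h⟩
      simp only [lK, this]
    · simp only [lK, hl' v w hF, ite_self]
  let d : V → V → L := fun K v => ∑ w, lK K s(v, w)
  have hdK : ∀ K v, cp v ≠ K → d K v = 0 := by
    intro K v hv
    simp only [d, hlK, if_neg hv, Finset.sum_const_zero]
  have hdU : ∀ K v, (∀ w, ¬ P.Adj v w) → d K v = 0 := by
    intro K v hv
    simp only [d, hlK]
    split_ifs
    · exact hl v hv
    · simp
  have hdsum : ∀ K, ∑ v, d K v = 0 := by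
    intro K
    apply symm_sum L_two (fun v w => lK K s(v, w))
    · intro v w; rw [Sym2.eq_swap]
    · intro v
      rw [hlK, hl' v v (by simp), ite_self]
  -- flows on the cycle
  have hs : ∀ K, ∃ f : Sym2 V → L, (∀ e, e ∉ P.edgeSet → f e = 0) ∧
      ∀ v, ∑ w, f s(v, w) = d K v := by
    intro K
    by_cases hne : ∃ u w, P.Adj u w
    · obtain ⟨u0, w0, h0⟩ := hne
      refine exists_flow P (fun v => if ∃ w, P.Adj v w then u0 else v) ?_ (d K) ?_
      · intro v
        split_ifs with h
        · exact hconn v u0 h ⟨w0, h0⟩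
        · exact SimpleGraph.Reachable.refl v
      · intro u
        by_cases hu : u = u0
        · refine Eq.trans (Finset.sum_congr rfl fun v _ => ?_) (hdsum K)
          by_cases h : ∃ w, P.Adj v w
          · rw [if_pos h, if_pos hu.symm]
          · rw [hdU K v (by push Not at h; exact h), ite_self]
        · apply Finset.sum_eq_zero
          intro v _
          by_cases h : ∃ w, P.Adj v w
          · rw [if_pos h, if_neg (Ne.symm hu)]
          · rw [hdU K v (by push Not at h; exact h), ite_self]
    · push Not at hne
      exact ⟨fun _ => 0, fun _ _ => rfl, fun v => by rw [hdU K v (hne v)]; simp⟩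
  choose s hs0 hs using hs
  let q : Fin 3 → Fin 3 → V → V → ZMod 2 := fun x y K K' =>
    ∑ v, (if cp v = K then
      ∑ w, (if P.Adj v w then om (rt x (s K s(v, w))) (rt y (s K' s(v, w))) else 0) else 0)
  have hrs0 : ∀ x K e, e ∉ P.edgeSet → rt x (s K e) = 0 := by
    intro x K e he
    rw [hs0 K e he, rt_zero]
  have hrs : ∀ x K v, cp v ≠ K → ∑ w, rt x (s K s(v, w)) = 0 := by
    intro x K v hv
    rw [← rt_finsum, hs, hdK K v hv, rt_zero]
  -- symmetry
  have hqs : ∀ x y K K', K ≠ K' → q x y K K' = q y x K' K := by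
    intro x y K K' hne
    have h1 := symm_sum (V := V) (A := ZMod 2) CharTwo.add_self_eq_zero
      (fun v w => if P.Adj v w then om (rt x (s K s(v, w))) (rt y (s K' s(v, w))) else 0)
      (by
        intro v w
        rw [Sym2.eq_swap]
        simp only [P.adj_comm v w]) (by intro v; simp)
    have h2 : ∀ v, ∑ w, (if P.Adj v w then
        om (rt x (s K s(v, w))) (rt y (s K' s(v, w))) else 0) =
        (if cp v = K then ∑ w, (if P.Adj v w then
          om (rt x (s K s(v, w))) (rt y (s K' s(v, w))) else 0) else 0) +
        (if cp v = K' then ∑ w, (if P.Adj v w then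
          om (rt y (s K' s(v, w))) (rt x (s K s(v, w))) else 0) else 0) := by
      intro v
      by_cases hK : cp v = K
      · have : cp v ≠ K' := fun h => hne (hK.symm.trans h)
        rw [if_pos hK, if_neg this, add_zero]
      · by_cases hK' : cp v = K'
        · rw [if_neg hK, if_pos hK', zero_add]
          refine Finset.sum_congr rfl fun w _ => ?_
          rw [om_symm]
        · rw [if_neg hK, if_neg hK', add_zero]
          refine loc (A := L × L) (fun a => Prod.ext (L_two _) (L_two _)) hP
            (fun e => (rt x (s K e), rt y (s K' e))) ?_ v ?_ (fun p => om p.1 p.2)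
          · intro e he
            rw [hrs0 x K e he, hrs0 y K' e he]; rfl
          · apply Prod.ext
            · rw [Prod.fst_sum]; exact hrs x K v hK
            · rw [Prod.snd_sum]; exact hrs y K' v hK'
    rw [Finset.sum_congr rfl (fun v _ => h2 v), Finset.sum_add_distrib] at h1
    exact CharTwo.add_eq_zero.mp h1
  have hqsum : ∀ y K K', ∑ x, q x y K K' = 0 := by
    intro y K K'
    simp only [q]
    rw [Finset.sum_comm]
    apply Finset.sum_eq_zero
    intro v _
    by_cases hv : cp v = K
    · simp only [if_pos hv]
      rw [Finset.sum_comm]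
      apply Finset.sum_eq_zero
      intro w _
      by_cases hw : P.Adj v w
      · simp only [if_pos hw]
        exact rt_sum _ _
      · simp [hw]
    · simp [hv]
  obtain ⟨σ, hσ⟩ := odd_count (I := V)
    (fun σ K K' => if K = K' then 1 else q (σ K) (σ K') K K')
    (by
      intro σ K K'
      by_cases h : K = K'
      · rw [h]
      · simp only [if_neg h, if_neg (Ne.symm h)]
        exact hqs _ _ _ _ h)
    (by intro σ v; simp)
    (by
      intro σ v w u a h1 h2
      simp only [Function.update_of_ne h1.symm, Function.update_of_ne h2.symm])
    (by
      intro σ v w h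
      simp only [if_neg h, Function.update_self, Function.update_of_ne h.symm]
      exact hqsum _ _ _)
  have hσ' : ∀ K, ∑ K' ∈ Finset.univ.erase K, q (σ K) (σ K') K K' = 0 := by
    intro K
    have h1 := hσ K
    rw [← Finset.add_sum_erase _ _ (Finset.mem_univ K)] at h1
    simp only [if_true] at h1
    have h2 : ∑ K' ∈ Finset.univ.erase K, (if K = K' then 1 else q (σ K) (σ K') K K') =
        ∑ K' ∈ Finset.univ.erase K, q (σ K) (σ K') K K' := by
      refine Finset.sum_congr rfl fun K' hK' => ?_
      rw [if_neg (Finset.ne_of_mem_erase hK').symm]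
    rw [h2] at h1
    exact left_eq_add.mp h1.symm
  have hψP : ∀ v w, P.Adj v w → ∀ K, lK K s(v, w) = 0 := by
    intro v w h K
    rw [hlK, hl' v w (hPF v w h), ite_self]
  refine ⟨fun e => ∑ K, rt (σ K) (lK K e + s K e), ?_, ?_, ?_, ?_⟩
  · intro e h1 h2
    apply Finset.sum_eq_zero
    intro K _
    simp only [lK]
    rw [hl0 e h2, hs0 K e h1, ite_self, add_zero, rt_zero]
  · intro e he
    induction e using Sym2.ind with
    | _ v w =>
      have hnP : s(v, w) ∉ P.edgeSet := fun h => hPF v w h he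
      have : ∑ K, rt (σ K) (lK K s(v, w) + s K s(v, w)) = rt (σ (cp v)) (l s(v, w)) := by
        rw [Finset.sum_eq_single (cp v)]
        · rw [hs0 _ _ hnP, hlK, if_pos rfl, add_zero]
        · intro K _ hK
          rw [hs0 _ _ hnP, hlK, if_neg hK.symm, add_zero, rt_zero]
        · simp
      simp only [this]
      exact rt_ne _ _ (hl1 _ he)
  · intro v
    rw [Finset.sum_comm]
    apply Finset.sum_eq_zero
    intro K _
    rw [← rt_finsum, Finset.sum_add_distrib, hs]
    change rt _ (d K v + d K v) = 0
    rw [L_two, rt_zero]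
  · intro K
    let r : Sym2 V → L := fun e => ∑ K' ∈ Finset.univ.erase K, rt (σ K') (s K' e)
    have hexp : ∀ v w, (if P.Adj v w then nz (∑ K, rt (σ K) (lK K s(v, w) + s K s(v, w))) else 0) =
        (if P.Adj v w then nz (rt (σ K) (s K s(v, w))) else 0) +
        (if P.Adj v w then nz (r s(v, w)) else 0) +
        ∑ K' ∈ Finset.univ.erase K, (if P.Adj v w then
          om (rt (σ K) (s K s(v, w))) (rt (σ K') (s K' s(v, w))) else 0) := by
      intro v w
      by_cases h : P.Adj v w
      · simp only [if_pos h, hψP v w h, zero_add]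
        rw [← Finset.add_sum_erase _ _ (Finset.mem_univ K), nz_add, om_finsum]
      · simp [h]
    have hA : ∑ v, (if cp v = K then
        ∑ w, (if P.Adj v w then nz (rt (σ K) (s K s(v, w))) else 0) else 0) = 0 := by
      have h1 := symm_sum (V := V) (A := ZMod 2) CharTwo.add_self_eq_zero
        (fun v w => if P.Adj v w then nz (rt (σ K) (s K s(v, w))) else 0)
        (by
          intro v w
          rw [Sym2.eq_swap]
          simp only [P.adj_comm v w]) (by intro v; simp)
      refine Eq.trans (Finset.sum_congr rfl fun v _ => ?_) h1
      split_ifs with hv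
      · rfl
      · exact (loc L_two hP (fun e => rt (σ K) (s K e)) (hrs0 (σ K) K) v
          (hrs (σ K) K v hv) nz).symm
    have hB : ∀ v, cp v = K → ∑ w, (if P.Adj v w then nz (r s(v, w)) else 0) = 0 := by
      intro v hv
      apply loc L_two hP r
      · intro e he
        apply Finset.sum_eq_zero
        intro K' _
        exact hrs0 _ _ e he
      · simp only [r]
        rw [Finset.sum_comm]
        apply Finset.sum_eq_zero
        intro K' hK'
        apply hrs
        rw [hv]
        exact (Finset.ne_of_mem_erase hK').symm
    have hC := hσ' K
    simp only [q] at hC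
    rw [Finset.sum_comm] at hC
    have hAC := congrArg₂ (· + ·) hA hC
    simp only [add_zero] at hAC
    rw [← Finset.sum_add_distrib] at hAC
    refine Eq.trans (Finset.sum_congr rfl fun v _ => ?_) hAC
    by_cases hv : cp v = K
    · simp only [if_pos hv, hexp]
      rw [Finset.sum_add_distrib, Finset.sum_add_distrib, hB v hv, add_zero]
      congr 1
      rw [Finset.sum_comm]
    · simp [hv]

end Flow

section Final
variable {V : Type*} [Fintype V]

/-- the subgraph given by a mod 2 edge function -/
def ofFn {G : SimpleGraph V} (f : Sym2 V → ZMod 2) (hf : ∀ e, e ∉ G.edgeSet → f e = 0) :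
    G.Subgraph where
  verts := Set.univ
  Adj v w := f s(v, w) ≠ 0
  adj_sub := by
    intro v w h
    by_contra hn
    exact h (hf _ hn)
  edge_vert := fun _ => Set.mem_univ _
  symm := ⟨fun v w h => by rwa [Sym2.eq_swap]⟩

lemma ofFn_edge {G : SimpleGraph V} (f : Sym2 V → ZMod 2) (hf : ∀ e, e ∉ G.edgeSet → f e = 0)
    (e : Sym2 V) : e ∈ (ofFn f hf).edgeSet ↔ f e ≠ 0 := by
  induction e using Sym2.ind with
  | _ v w => rfl

lemma ofFn_even {G : SimpleGraph V} (f : Sym2 V → ZMod 2) (hf : ∀ e, e ∉ G.edgeSet → f e = 0)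
    (h : ∀ v, ∑ w, f s(v, w) = 0) : IsEvenSubgraph (ofFn f hf) := by
  intro v
  have h1 : (ofFn f hf).neighborSet v = ((Finset.univ.filter (fun w => f s(v, w) ≠ 0) : Finset V) :
      Set V) := by
    ext w
    simp [SimpleGraph.Subgraph.mem_neighborSet, ofFn]
  rw [h1, Set.ncard_coe_finset, ← ZMod.natCast_eq_zero_iff_even, Finset.card_filter]
  push_cast
  refine Eq.trans (Finset.sum_congr rfl fun w _ => ?_) (h v)
  generalize f s(v, w) = x
  revert x; decide

def col (k : Fin 3) : L := if k = 0 then (1, 0) else if k = 1 then (0, 1) else (1, 1)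

lemma col_ne (k : Fin 3) : col k ≠ 0 := by revert k; decide
lemma col_sum : ∑ k, col k = 0 := by decide

lemma cover_cycle (x : L) :
    (if (0 : ZMod 2) ≠ 0 then 1 else 0) +
    (if (if x = 0 then (1 : ZMod 2) else 0) + 1 + om (1, 1) x ≠ 0 then 1 else 0) +
    (if (if x = 0 then (1 : ZMod 2) else 0) + 1 + om (0, 1) x ≠ 0 then 1 else 0) +
    (if (if x = 0 then (1 : ZMod 2) else 0) + 1 + om (1, 0) x ≠ 0 then 1 else 0) +
    (if (if x = 0 then (1 : ZMod 2) else 0) ≠ 0 then 1 else 0) = 1 := by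
  revert x; decide

lemma cover_chord (x : L) (hx : x ≠ 0) (g : ZMod 2) :
    (if g + om (1, 1) x ≠ 0 then 1 else 0) +
    (if g + om (0, 1) x ≠ 0 then 1 else 0) +
    (if g + om (1, 0) x ≠ 0 then 1 else 0) +
    (if g ≠ 0 then 1 else 0) = 2 := by
  revert x g; decide

lemma build {G P F : SimpleGraph V} (hP : Deg02 P) (hPG : P ≤ G) (hFG : F ≤ G)
    (hPF : ∀ e, e ∈ P.edgeSet → e ∉ F.edgeSet)
    (hG : ∀ e ∈ G.edgeSet, e ∈ P.edgeSet ∨ e ∈ F.edgeSet)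
    (cp : V → V) (hcp : ∀ v, F.Reachable v (cp v))
    (ψ : Sym2 V → L) (hψ0 : ∀ e, e ∉ P.edgeSet → e ∉ F.edgeSet → ψ e = 0)
    (hψ1 : ∀ e ∈ F.edgeSet, ψ e ≠ 0) (hψ : ∀ v, ∑ w, ψ s(v, w) = 0)
    (hT : ∀ K : V, ∑ v, (if cp v = K then
      ∑ w, (if P.Adj v w then nz (ψ s(v, w)) else 0) else 0) = 0) :
    ∃ D : Multiset G.Subgraph, IsKCDC G 6 D := by
  let p : Sym2 V → ZMod 2 := fun e => if e ∈ P.edgeSet then 1 else 0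
  let z : Sym2 V → ZMod 2 := fun e => if e ∈ P.edgeSet then (if ψ e = 0 then 1 else 0) else 0
  have hGP : ∀ e, e ∉ G.edgeSet → e ∉ P.edgeSet := fun e he h =>
    he (SimpleGraph.edgeSet_mono hPG h)
  have hGF : ∀ e, e ∉ G.edgeSet → e ∉ F.edgeSet := fun e he h =>
    he (SimpleGraph.edgeSet_mono hFG h)
  have hp : ∀ v, ∑ w, p s(v, w) = 0 := fun v =>
    loc (A := ZMod 2) CharTwo.add_self_eq_zero hP (fun _ => 0) (fun _ _ => rfl) v (by simp)
      (fun _ => 1)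
  have hz : ∀ v, ∑ w, z s(v, w) = ∑ w, (if P.Adj v w then nz (ψ s(v, w)) else 0) := by
    intro v
    have key : ∑ w, (p s(v, w) + z s(v, w)) = ∑ w, z s(v, w) := by
      rw [Finset.sum_add_distrib, hp, zero_add]
    rw [← key]
    refine Finset.sum_congr rfl fun w _ => ?_
    simp only [p, z, SimpleGraph.mem_edgeSet, nz_eq]
    split_ifs
    · exact CharTwo.add_self_eq_zero _
    · simp
    · simp
  obtain ⟨g, hg0, hg⟩ := exists_flow F cp hcp (fun v => ∑ w, z s(v, w)) (by
    intro K
    simp only [hz]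
    exact hT K)
  let f0 : Sym2 V → ZMod 2 := fun e => g e + z e
  let fx : L → Sym2 V → ZMod 2 := fun x e => g e + z e + p e + om x (ψ e)
  have hp0 : ∀ e, e ∉ G.edgeSet → p e = 0 := fun e he => if_neg (hGP e he)
  have hf0 : ∀ e, e ∉ G.edgeSet → f0 e = 0 := by
    intro e he
    simp only [f0, z, hg0 e (hGF e he), if_neg (hGP e he), add_zero]
  have hfx : ∀ x e, e ∉ G.edgeSet → fx x e = 0 := by
    intro x e he
    have := hf0 e he
    simp only [f0] at this
    simp only [fx, this, hp0 e he, hψ0 e (hGP e he) (hGF e he), om_zero, add_zero]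
  have bf0 : ∀ v, ∑ w, f0 s(v, w) = 0 := by
    intro v
    simp only [f0]
    rw [Finset.sum_add_distrib, hg, CharTwo.add_self_eq_zero]
  have bfx : ∀ x v, ∑ w, fx x s(v, w) = 0 := by
    intro x v
    simp only [fx]
    rw [Finset.sum_add_distrib, Finset.sum_add_distrib, hp, ← om_finsum, hψ, om_zero]
    simpa using bf0 v
  refine ⟨{ofFn p hp0, ofFn f0 hf0, ofFn (fx (1, 0)) (hfx _), ofFn (fx (0, 1)) (hfx _),
    ofFn (fx (1, 1)) (hfx _), ofFn (fun _ => 0) (fun _ _ => rfl)}, by simp, ?_, ?_⟩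
  · intro H hH
    simp only [Multiset.insert_eq_cons, Multiset.mem_cons, Multiset.mem_singleton] at hH
    rcases hH with rfl | rfl | rfl | rfl | rfl | rfl
    · exact ofFn_even _ _ hp
    · exact ofFn_even _ _ bf0
    · exact ofFn_even _ _ (bfx _)
    · exact ofFn_even _ _ (bfx _)
    · exact ofFn_even _ _ (bfx _)
    · exact ofFn_even _ _ (by simp)
  · intro e he
    simp only [Multiset.insert_eq_cons, Multiset.countP_cons, ← Multiset.cons_zero,
      Multiset.countP_zero, ofFn_edge]
    by_cases heP : e ∈ P.edgeSet
    · have h1 := cover_cycle (ψ e)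
      have h2 : p e = 1 := if_pos heP
      have h3 : z e = if ψ e = 0 then 1 else 0 := if_pos heP
      have h4 := hg0 e (hPF e heP)
      simp only [f0, fx, h2, h3, h4, zero_add]
      simp only [ne_eq, not_true_eq_false, if_false, one_ne_zero, not_false_eq_true, if_true,
        zero_add] at h1 ⊢
      omega
    · have heF := (hG e he).resolve_left heP
      have h1 := cover_chord (ψ e) (hψ1 e heF) (g e)
      have h2 : p e = 0 := if_neg heP
      have h3 : z e = 0 := if_neg heP
      simp only [f0, fx, h2, h3, add_zero]
      simp only [ne_eq, not_true_eq_false, if_false, zero_add, add_zero] at h1 ⊢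
      exact h1

end Final

/-- a bridgeless cubic graph of order n with a cycle of length at least n - 8
has a 6-CDC. -/
theorem six_cdc_of_long_cycle {V : Type*} [Fintype V]
    (G : SimpleGraph V) (hG : IsCubic G)
    (hbridgeless : ∀ e, ¬ G.IsBridge e)
    (C : G.Subgraph) (hC : IsCycleSub C)
    (hlong : Fintype.card V - 8 ≤ C.verts.ncard) :
    ∃ D : Multiset G.Subgraph, IsKCDC G 6 D := by
  have hdG : ∀ v, G.degree v = 3 := by
    intro v
    rw [← hG v, ← SimpleGraph.card_neighborFinset_eq_degree, ← Set.ncard_coe_finset,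
      SimpleGraph.coe_neighborFinset]
  obtain ⟨P, hPadj⟩ : ∃ P : SimpleGraph V, ∀ v w, P.Adj v w ↔ C.Adj v w :=
    ⟨C.spanningCoe, fun _ _ => Iff.rfl⟩
  obtain ⟨F, hFadj⟩ : ∃ F : SimpleGraph V, ∀ v w, F.Adj v w ↔ (G.Adj v w ∧ ¬ C.Adj v w) :=
    ⟨G \ C.spanningCoe, fun v w => by rw [SimpleGraph.sdiff_adj]; rfl⟩
  have hPG : P ≤ G := fun v w h => ((hPadj v w).mp h).adj_sub
  have hFG : F ≤ G := fun v w h => ((hFadj v w).mp h).1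
  have hin : ∀ v, v ∈ C.verts → ∃ a b, a ≠ b ∧ ∀ w, C.Adj v w ↔ w = a ∨ w = b := by
    intro v hv
    obtain ⟨a, b, hab, h⟩ := Set.ncard_eq_two.mp (hC.2 v hv)
    refine ⟨a, b, hab, fun w => ?_⟩
    rw [← SimpleGraph.Subgraph.mem_neighborSet, h]
    simp
  have hout : ∀ v, v ∉ C.verts → ∀ w, ¬ C.Adj v w := fun v hv w h => hv (C.edge_vert h)
  have hP : Deg02 P := by
    intro v
    by_cases hv : v ∈ C.verts
    · left
      simpa only [hPadj] using hin v hv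
    · right
      simpa only [hPadj] using hout v hv
  have hconn : ∀ u v, (∃ w, P.Adj u w) → (∃ w, P.Adj v w) → P.Reachable u v := by
    rintro u v ⟨w, hw⟩ ⟨w', hw'⟩
    rw [hPadj] at hw hw'
    have h1 := hC.1.coe.preconnected ⟨u, C.edge_vert hw⟩ ⟨v, C.edge_vert hw'⟩
    let φ : C.coe →g P := ⟨Subtype.val, fun {a b} h => (hPadj _ _).mpr h⟩
    exact h1.map φ
  have hPF : ∀ v w, P.Adj v w → ¬ F.Adj v w := by
    intro v w h h'
    exact ((hFadj v w).mp h').2 ((hPadj v w).mp h)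
  have h8 : (Finset.univ.filter (fun v => 2 ≤ F.degree v)).card ≤ 8 := by
    have hsub : Finset.univ.filter (fun v => 2 ≤ F.degree v) ⊆
        Finset.univ.filter (fun v => v ∉ C.verts) := by
      intro v hv
      simp only [Finset.mem_filter, Finset.mem_univ, true_and] at hv ⊢
      intro hvC
      obtain ⟨a, b, hab, h⟩ := hin v hvC
      have h1 : insert a (insert b (F.neighborFinset v)) ⊆ G.neighborFinset v := by
        intro w hw
        simp only [Finset.mem_insert, SimpleGraph.mem_neighborFinset] at hw ⊢
        rcases hw with rfl | rfl | hw
        · exact ((h w).mpr (Or.inl rfl)).adj_sub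
        · exact ((h w).mpr (Or.inr rfl)).adj_sub
        · exact hFG hw
      have h2 := Finset.card_le_card h1
      rw [Finset.card_insert_of_notMem, Finset.card_insert_of_notMem,
        SimpleGraph.card_neighborFinset_eq_degree, SimpleGraph.card_neighborFinset_eq_degree,
        hdG] at h2
      · omega
      · simp [hFadj, h]
      · simp [hFadj, h, hab]
    refine (Finset.card_le_card hsub).trans ?_
    have h1 : C.verts.ncard = (Finset.univ.filter (fun v => v ∈ C.verts)).card := by
      rw [← Set.ncard_coe_finset]
      congr 1
      ext v; simp
    have h2 := Finset.card_filter_add_card_filter_not (s := (Finset.univ : Finset V))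
      (fun v => v ∈ C.verts)
    rw [Finset.card_univ] at h2
    omega
  obtain ⟨c, hc⟩ := exists_colouring hdG hbridgeless hFG h8
  let l : Sym2 V → L := fun e => if e ∈ F.edgeSet then col (c e) else 0
  have hl : ∀ v, (∀ w, ¬ P.Adj v w) → ∑ w, l s(v, w) = 0 := by
    intro v hv
    have hnb : F.neighborFinset v = G.neighborFinset v := by
      ext w
      simp only [SimpleGraph.mem_neighborFinset, hFadj]
      have := hv w
      rw [hPadj] at this
      tauto
    have hseen : seen F c v = Finset.univ := by
      rw [← Finset.card_eq_iff_eq_univ, card_seen hc,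
        ← SimpleGraph.card_neighborFinset_eq_degree, hnb,
        SimpleGraph.card_neighborFinset_eq_degree, hdG]
      rfl
    rw [← col_sum, ← hseen, seen, Finset.sum_image, SimpleGraph.neighborFinset_eq_filter,
      Finset.sum_filter]
    · rfl
    · intro w hw w' hw' e
      simp only [SimpleGraph.coe_neighborFinset, SimpleGraph.mem_neighborSet] at hw hw'
      exact hc v w w' hw hw' e
  let cp : V → V := fun v => (F.connectedComponentMk v).out
  obtain ⟨ψ, h1, h2, h3, h4⟩ := exists_psi hP hconn hPF cp
    (fun v w h => by
      have : F.connectedComponentMk v = F.connectedComponentMk w :=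
        SimpleGraph.ConnectedComponent.sound h.reachable
      simp only [cp, this])
    l (fun e he => if_neg he) (fun e he => by simp only [l, if_pos he]; exact col_ne _) hl
  refine build hP hPG hFG ?_ ?_ cp ?_ ψ h1 h2 h3 h4
  · intro e
    induction e using Sym2.ind with
    | _ v w => exact hPF v w
  · intro e
    induction e using Sym2.ind with
    | _ v w =>
      intro h
      simp only [SimpleGraph.mem_edgeSet, hPadj, hFadj] at h ⊢
      tauto
  · intro v
    exact (SimpleGraph.ConnectedComponent.exact (Quot.out_eq (F.connectedComponentMk v))).symm

end SnarkPaper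
end

section
/- Every colourable cubic graph with m edges has a cycle cover of length at most 4m/3. -/
open scoped Classical

namespace SnarkPaper

variable {V : Type*}

theorem comp_cover {V : Type*} [Fintype V] (G H : SimpleGraph V) (hle : H ≤ G)
    (h2 : ∀ v, (H.neighborSet v).ncard = 2) :
    ∃ F : Finset G.Subgraph, (∀ K ∈ F, IsCycleSub K) ∧
      (∀ e ∈ H.edgeSet, ∃ K ∈ F, e ∈ K.edgeSet) ∧
      ∑ K ∈ F, K.edgeSet.ncard ≤ H.edgeSet.ncard := by
  let K : V → G.Subgraph := fun v =>
    { verts := {w | H.Reachable v w}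
      Adj := fun a b => H.Adj a b ∧ H.Reachable v a
      adj_sub := fun h => hle h.1
      edge_vert := fun h => h.2
      symm := ⟨fun a b h => ⟨h.1.symm, h.2.trans h.1.reachable⟩⟩ }
  have hK : ∀ u v, H.Reachable u v → K u = K v := by
    intro u v huv
    have hx : ∀ a, H.Reachable u a ↔ H.Reachable v a :=
      fun a => ⟨fun h => huv.symm.trans h, fun h => huv.trans h⟩
    ext a b
    · exact hx a
    · change (H.Adj a b ∧ H.Reachable u a) ↔ (H.Adj a b ∧ H.Reachable v a)
      rw [hx]
  refine ⟨Finset.univ.image K, ?_, ?_, ?_⟩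
  · intro C hC
    obtain ⟨v, -, rfl⟩ := Finset.mem_image.1 hC
    refine ⟨?_, ?_⟩
    · have key : ∀ w, H.Reachable v w → ∃ hw : w ∈ (K v).verts,
          (K v).coe.Reachable ⟨v, SimpleGraph.Reachable.refl v⟩ ⟨w, hw⟩ := by
        intro w hw
        rw [SimpleGraph.reachable_iff_reflTransGen] at hw
        induction hw with
        | refl => exact ⟨SimpleGraph.Reachable.refl v, SimpleGraph.Reachable.refl _⟩
        | tail _ hab ih =>
          obtain ⟨hb, hr⟩ := ih
          refine ⟨SimpleGraph.Reachable.trans hb hab.reachable, hr.trans ?_⟩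
          apply SimpleGraph.Adj.reachable
          exact ⟨hab, hb⟩
      rw [SimpleGraph.Subgraph.connected_iff']
      haveI : Nonempty (K v).verts := ⟨⟨v, SimpleGraph.Reachable.refl v⟩⟩
      refine ⟨fun a b => ?_⟩
      exact (key a.1 a.2).2.symm.trans (key b.1 b.2).2
    · intro w hw
      rw [← h2 w]
      congr 1
      ext x
      exact ⟨fun h => h.1, fun h => ⟨h, hw⟩⟩
  · intro e he
    induction e using Sym2.ind with
    | _ a b =>
      exact ⟨K a, Finset.mem_image_of_mem _ (Finset.mem_univ _),
        he, SimpleGraph.Reachable.refl a⟩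
  · have hdis : ∀ C ∈ Finset.univ.image K, ∀ D ∈ Finset.univ.image K, C ≠ D →
        Disjoint C.edgeSet.toFinset D.edgeSet.toFinset := by
      intro C hC D hD hne
      obtain ⟨u, -, rfl⟩ := Finset.mem_image.1 hC
      obtain ⟨v, -, rfl⟩ := Finset.mem_image.1 hD
      rw [Finset.disjoint_left]
      intro e he he'
      rw [Set.mem_toFinset] at he he'
      induction e using Sym2.ind with
      | _ a b => exact hne (hK u v (SimpleGraph.Reachable.trans he.2 he'.2.symm))
    have h1 : ∑ C ∈ Finset.univ.image K, C.edgeSet.ncard =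
        ((Finset.univ.image K).biUnion fun C => C.edgeSet.toFinset).card := by
      rw [Finset.card_biUnion hdis]
      exact Finset.sum_congr rfl fun C _ => Set.ncard_eq_toFinset_card' _
    rw [h1, Set.ncard_eq_toFinset_card' H.edgeSet]
    apply Finset.card_le_card
    intro e he
    obtain ⟨C, hC, he⟩ := Finset.mem_biUnion.1 he
    obtain ⟨u, -, rfl⟩ := Finset.mem_image.1 hC
    rw [Set.mem_toFinset] at he ⊢
    induction e using Sym2.ind with
    | _ a b => exact he.1

theorem count_edges {V : Type*} [Fintype V] (H : SimpleGraph V) (d : ℕ)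
    (h : ∀ v, (H.neighborSet v).ncard = d) :
    2 * H.edgeSet.ncard = d * Fintype.card V := by
  have h1 := H.sum_degrees_eq_twice_card_edges
  have h2 : ∀ v, H.degree v = d := fun v => by
    rw [← h v, Set.ncard_eq_toFinset_card', ← SimpleGraph.card_neighborFinset_eq_degree]
    rfl
  rw [Set.ncard_eq_toFinset_card']
  simp only [h2, Finset.sum_const, Finset.card_univ, smul_eq_mul] at h1
  rw [mul_comm d, h1]
  rfl

theorem two_colours {V : Type*} [Fintype V] (G : SimpleGraph V) (hG : IsCubic G)
    (c : Sym2 V → Fin 3) (hc : ∀ e₁ ∈ G.edgeSet, ∀ e₂ ∈ G.edgeSet,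
      e₁ ≠ e₂ → (∃ v, v ∈ e₁ ∧ v ∈ e₂) → c e₁ ≠ c e₂) (k : Fin 3) :
    ∃ H : SimpleGraph V, H ≤ G ∧ (∀ v, (H.neighborSet v).ncard = 2) ∧
      ∀ e ∈ G.edgeSet, c e ≠ k → e ∈ H.edgeSet := by
  let H : SimpleGraph V :=
    { Adj := fun a b => G.Adj a b ∧ c s(a, b) ≠ k
      symm := ⟨fun a b h => ⟨h.1.symm, by rw [Sym2.eq_swap]; exact h.2⟩⟩
      loopless := ⟨fun a h => G.loopless.irrefl a h.1⟩ }
  refine ⟨H, fun a b h => h.1, fun v => ?_, ?_⟩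
  · have hinj : Set.InjOn (fun w => c s(v, w)) (G.neighborSet v) := by
      intro a ha b hb hab
      by_contra hne
      refine hc s(v, a) ha s(v, b) hb ?_ ⟨v, by simp, by simp⟩ hab
      intro h
      exact hne (Sym2.congr_right.1 h)
    have himg : (fun w => c s(v, w)) '' G.neighborSet v = Set.univ := by
      apply Set.eq_of_subset_of_ncard_le (Set.subset_univ _)
      rw [Set.ncard_image_of_injOn hinj, hG v]
      simp [Set.ncard_univ]
    have hsub : H.neighborSet v ⊆ G.neighborSet v := fun w h => h.1
    rw [← Set.ncard_image_of_injOn (hinj.mono hsub)]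
    have : (fun w => c s(v, w)) '' H.neighborSet v = {k}ᶜ := by
      ext i
      constructor
      · rintro ⟨w, hw, rfl⟩
        exact hw.2
      · intro hi
        obtain ⟨w, hw, rfl⟩ := himg.symm ▸ Set.mem_univ i
        exact ⟨w, ⟨hw, hi⟩, rfl⟩
    rw [this, Set.ncard_compl]
    simp
  · intro e he hk
    induction e using Sym2.ind with
    | _ a b => exact ⟨he, hk⟩

/-- every colourable cubic graph with m edges has a cycle cover of length at
most 4m/3. -/
theorem short_cycle_cover_of_colourable {V : Type*} [Fintype V]
    (G : SimpleGraph V) (hG : IsCubic G) (hcol : Colourable3 G) :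
    ∃ F : Finset G.Subgraph, (∀ K ∈ F, IsCycleSub K) ∧
      (∀ e ∈ G.edgeSet, ∃ K ∈ F, e ∈ K.edgeSet) ∧
      3 * ∑ K ∈ F, K.edgeSet.ncard ≤ 4 * G.edgeSet.ncard := by
  obtain ⟨c, hc⟩ := hcol
  obtain ⟨H, hle, h2, hcov⟩ := two_colours G hG c hc 0
  obtain ⟨H', hle', h2', hcov'⟩ := two_colours G hG c hc 1
  obtain ⟨F, hF, hFc, hFs⟩ := comp_cover G H hle h2
  obtain ⟨F', hF', hFc', hFs'⟩ := comp_cover G H' hle' h2'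
  refine ⟨F ∪ F', ?_, ?_, ?_⟩
  · intro K hK
    rcases Finset.mem_union.1 hK with h | h
    · exact hF K h
    · exact hF' K h
  · intro e he
    by_cases h0 : c e = 0
    · obtain ⟨K, hK, hm⟩ := hFc' e (hcov' e he (by rw [h0]; decide))
      exact ⟨K, Finset.mem_union_right _ hK, hm⟩
    · obtain ⟨K, hK, hm⟩ := hFc e (hcov e he h0)
      exact ⟨K, Finset.mem_union_left _ hK, hm⟩
  · have hu : ∑ K ∈ F ∪ F', K.edgeSet.ncard ≤
        ∑ K ∈ F, K.edgeSet.ncard + ∑ K ∈ F', K.edgeSet.ncard := by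
      rw [← Finset.sum_union_inter]
      exact Nat.le_add_right _ _
    have e1 := count_edges H 2 h2
    have e2 := count_edges H' 2 h2'
    have e3 := count_edges G 3 hG
    omega

end SnarkPaper
end

section
/- Every cubic permutation graph whose number of vertices is divisible by 4 is colourable. Consequently, every permutation snark has order congruent to 2 modulo 4. -/
open scoped Classical

namespace SnarkPaper

variable {V : Type*}

/-- A finite connected 2-regular graph has a cyclic enumeration of its vertices. -/
lemma exists_cyclic_enum {W : Type*} [Finite W] (H : SimpleGraph W) (hc : H.Connected)
    (h2 : ∀ v, (H.neighborSet v).ncard = 2) :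
    ∃ f : ℕ → W, 3 ≤ Nat.card W ∧ (∀ i j, f i = f j ↔ i ≡ j [MOD Nat.card W]) ∧
      (∀ i, H.Adj (f i) (f (i + 1))) ∧ (∀ w, ∃ i, f i = w) := by
  obtain ⟨v⟩ := hc.nonempty
  have hcyc : H.IsCycles := fun v _ => h2 v
  have hne : (H.neighborSet v).Nonempty := by
    apply Set.nonempty_of_ncard_ne_zero
    rw [h2 v]; norm_num
  obtain ⟨p, hp, hsupp⟩ := hcyc.exists_cycle_toSubgraph_verts_eq_connectedComponentSupp
    (c := H.connectedComponentMk v) rfl hne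
  have h3 := hp.three_le_length
  have hpos : 0 < p.length := by omega
  have hinj : ∀ i j, i < p.length → j < p.length → p.getVert i = p.getVert j → i = j := by
    intro i j hi hj h
    exact hp.getVert_injOn' (by simp only [Set.mem_ofPred_eq]; omega)
      (by simp only [Set.mem_ofPred_eq]; omega) h
  have hsurj : ∀ w, ∃ i, i < p.length ∧ p.getVert i = w := by
    intro w
    have hw : w ∈ p.toSubgraph.verts := by
      rw [hsupp]
      exact SimpleGraph.ConnectedComponent.sound (hc.preconnected w v)
    rw [SimpleGraph.Walk.mem_verts_toSubgraph,
      SimpleGraph.Walk.mem_support_iff_exists_getVert] at hw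
    obtain ⟨n, hn, hnl⟩ := hw
    rcases hnl.lt_or_eq with h | h
    · exact ⟨n, h, hn⟩
    · refine ⟨0, hpos, ?_⟩
      rw [← hn, h]; simp
  have hcard : Nat.card W = p.length := by
    have hb : Function.Bijective (fun i : Fin p.length => p.getVert i) := by
      constructor
      · intro i j h
        exact Fin.ext (hinj _ _ i.2 j.2 h)
      · intro w
        obtain ⟨i, hi, h⟩ := hsurj w
        exact ⟨⟨i, hi⟩, h⟩
    rw [← Nat.card_congr (Equiv.ofBijective _ hb)]; simp
  rw [hcard]
  refine ⟨fun i => p.getVert (i % p.length), h3, ?_, ?_, ?_⟩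
  · intro i j
    constructor
    · intro h
      exact hinj _ _ (Nat.mod_lt _ hpos) (Nat.mod_lt _ hpos) h
    · intro h
      have h' : i % p.length = j % p.length := h
      simp only [h']
  · intro i
    have hlt := Nat.mod_lt i hpos
    have hadj := p.adj_getVert_succ hlt
    have heq : p.getVert (i % p.length + 1) = p.getVert ((i + 1) % p.length) := by
      rcases (show i % p.length + 1 ≤ p.length from hlt).lt_or_eq with h | h
      · rw [Nat.add_mod, Nat.mod_eq_of_lt (show 1 < p.length by omega), Nat.mod_eq_of_lt h]
      · have : (i + 1) % p.length = 0 := by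
          rw [Nat.add_mod, Nat.mod_eq_of_lt (show 1 < p.length by omega), h, Nat.mod_self]
        rw [this, h]; simp
    rw [heq] at hadj
    exact hadj
  · intro w
    obtain ⟨i, hi, h⟩ := hsurj w
    exact ⟨i, by simp only [Nat.mod_eq_of_lt hi]; exact h⟩

/-- An even cycle has an alternating edge labelling. -/
lemma exists_alternating {V : Type*} [Finite V] {G : SimpleGraph V} (C : G.Subgraph)
    (hC : IsCycleSub C) (hev : Even C.verts.ncard) :
    ∃ M : Sym2 V → Prop, ∀ v a b, C.Adj v a → C.Adj v b → a ≠ b →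
      (M s(v, a) ↔ ¬ M s(v, b)) := by
  have hreg : ∀ v, (C.coe.neighborSet v).ncard = 2 := by
    intro v
    rw [← hC.2 v v.2]
    rw [← Set.ncard_image_of_injective _ Subtype.val_injective]
    congr 1
    ext w
    simp only [Set.mem_image, SimpleGraph.mem_neighborSet, SimpleGraph.Subgraph.coe_adj,
      SimpleGraph.Subgraph.mem_neighborSet]
    constructor
    · rintro ⟨x, hx, rfl⟩; exact hx
    · intro h; exact ⟨⟨w, h.snd_mem⟩, h, rfl⟩
  obtain ⟨f, h3, hf, hadj, hsurj⟩ := exists_cyclic_enum C.coe hC.1.coe hreg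
  have hcard : Nat.card C.verts = C.verts.ncard := rfl
  rw [hcard] at h3 hf
  generalize C.verts.ncard = m at *
  obtain ⟨n, rfl⟩ := hev
  set g : ℕ → V := fun i => (f i : V) with hg
  have hgf : ∀ i j, g i = g j ↔ i ≡ j [MOD (n + n)] := by
    intro i j; rw [← hf]; exact Subtype.val_injective.eq_iff
  have hpar : ∀ i j, g i = g j → (Even i ↔ Even j) := by
    intro i j h
    have h1 : i ≡ j [MOD 2] := ((hgf i j).1 h).of_dvd ⟨n, by ring⟩
    rw [Nat.even_iff, Nat.even_iff, h1]
  have hno2 : ∀ i, g i ≠ g (i + 2) := by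
    intro i h
    have h1 := (Nat.modEq_iff_dvd' (by omega)).1 ((hgf _ _).1 h)
    have := Nat.le_of_dvd (by omega) h1
    omega
  have hadjg : ∀ i, C.Adj (g i) (g (i + 1)) := fun i => hadj i
  set M : Sym2 V → Prop := fun e => ∃ i, Even i ∧ e = s(g i, g (i + 1)) with hM
  have hMi : ∀ i, M s(g i, g (i + 1)) ↔ Even i := by
    intro i
    constructor
    · rintro ⟨k, hk, he⟩
      rw [Sym2.eq_iff] at he
      rcases he with ⟨h1, _⟩ | ⟨h1, h2⟩
      · exact (hpar _ _ h1).2 hk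
      · exfalso
        apply hno2 k
        rw [← h2]
        rw [hgf] at h1 ⊢
        exact h1.add_right 1
    · intro h; exact ⟨i, h, rfl⟩
  have hnb : ∀ i a, C.Adj (g (i + 1)) a → a = g i ∨ a = g (i + 2) := by
    intro i a ha
    have hsub : ({g i, g (i + 2)} : Set V) ⊆ C.neighborSet (g (i + 1)) := by
      rintro x (rfl | rfl)
      · exact (hadjg i).symm
      · exact hadjg (i + 1)
    have heq := Set.eq_of_subset_of_ncard_le hsub (by
      rw [hC.2 _ (hadjg i).snd_mem, Set.ncard_pair (hno2 i)]) (Set.toFinite _)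
    have : a ∈ C.neighborSet (g (i + 1)) := ha
    rw [← heq] at this
    exact this
  refine ⟨M, ?_⟩
  intro v a b ha hb hab
  obtain ⟨i, hi⟩ : ∃ i, g (i + 1) = v := by
    obtain ⟨i, hi⟩ := hsurj ⟨v, ha.fst_mem⟩
    refine ⟨i + (n + n) - 1, ?_⟩
    have h1 : g i = v := congrArg Subtype.val hi
    rw [← h1, hgf, show i + (n + n) - 1 + 1 = i + (n + n) by omega]
    exact Nat.add_mod_right i (n + n)
  subst hi
  have e1 : M s(g (i + 1), g i) ↔ Even i := by rw [Sym2.eq_swap]; exact hMi i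
  have e2 : M s(g (i + 1), g (i + 2)) ↔ Even (i + 1) := hMi (i + 1)
  rw [Nat.even_add_one] at e2
  rcases hnb i a ha with rfl | rfl <;> rcases hnb i b hb with rfl | rfl
  · exact absurd rfl hab
  · rw [e1, e2]; tauto
  · rw [e1, e2]
  · exact absurd rfl hab

/-- Each vertex of an induced cycle has exactly one neighbour off the cycle. -/
lemma ncard_off {V : Type*} [Finite V] {G : SimpleGraph V} (hG : IsCubic G) (C : G.Subgraph)
    (hC : IsTwoRegular C) (v : V) (hv : v ∈ C.verts) :
    (G.neighborSet v \ C.neighborSet v).ncard = 1 := by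
  rw [Set.ncard_sdiff (C.neighborSet_subset v) (Set.toFinite _), hG v, hC v hv]

/-- The two cycles of a permutation graph have half of the vertices each. -/
lemma card_cycles {V : Type*} [Finite V] {G : SimpleGraph V} (hG : IsCubic G)
    (C₁ C₂ : G.Subgraph) (h1 : IsTwoRegular C₁) (h2 : IsTwoRegular C₂)
    (i1 : C₁.IsInduced) (i2 : C₂.IsInduced) (hd : Disjoint C₁.verts C₂.verts)
    (hs : ∀ v, v ∈ C₁.verts ∨ v ∈ C₂.verts) :
    C₁.verts.ncard = C₂.verts.ncard ∧ Nat.card V = C₁.verts.ncard + C₂.verts.ncard := by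
  have hfin : Fintype V := Fintype.ofFinite V
  have key : ∀ (A B : G.Subgraph), IsTwoRegular A → A.IsInduced →
      Disjoint A.verts B.verts → (∀ v, v ∈ A.verts ∨ v ∈ B.verts) → ∀ v ∈ A.verts,
      {w | w ∈ B.verts ∧ G.Adj v w}.ncard = 1 := by
    intro A B hA iA hAB hAs v hv
    rw [← ncard_off hG A hA v hv]
    congr 1
    ext w
    simp only [Set.mem_setOf_eq, Set.mem_sdiff, SimpleGraph.mem_neighborSet,
      SimpleGraph.Subgraph.mem_neighborSet]
    constructor
    · rintro ⟨hw, ha⟩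
      exact ⟨ha, fun h => Set.disjoint_left.1 hAB h.snd_mem hw⟩
    · rintro ⟨ha, hn⟩
      refine ⟨(hAs w).resolve_left fun hw => hn (iA hv hw ha), ha⟩
  constructor
  · have := Finset.card_mul_eq_card_mul (s := C₁.verts.toFinset) (t := C₂.verts.toFinset)
      (r := G.Adj) (m := 1) (n := 1) ?_ ?_
    · rw [Set.ncard_eq_toFinset_card', Set.ncard_eq_toFinset_card']; omega
    · intro a ha
      rw [← key C₁ C₂ h1 i1 hd hs a (by simpa using ha), ← Set.ncard_coe_finset]
      congr 1
      ext w
      simp [Finset.bipartiteAbove]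
    · intro a ha
      rw [← key C₂ C₁ h2 i2 hd.symm (fun v => (hs v).symm) a (by simpa using ha),
        ← Set.ncard_coe_finset]
      congr 1
      ext w
      simp [Finset.bipartiteBelow, G.adj_comm]
  · rw [← Set.ncard_union_eq hd, ← Set.ncard_univ]
    congr 1
    ext v
    simpa using hs v

/-- Local version of the properness of the colouring at a vertex on one of the cycles. -/
lemma not_both_off {V : Type*} [Finite V] {G : SimpleGraph V} (hG : IsCubic G) (C : G.Subgraph)
    (hC : IsTwoRegular C) (v a b : V) (hv : v ∈ C.verts) (ha : G.Adj v a) (hb : G.Adj v b)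
    (hab : a ≠ b) : C.Adj v a ∨ C.Adj v b := by
  by_contra! h
  have h1 := ncard_off hG C hC v hv
  obtain ⟨x, hx⟩ := Set.ncard_eq_one.1 h1
  have hax : a ∈ G.neighborSet v \ C.neighborSet v := ⟨ha, h.1⟩
  have hbx : b ∈ G.neighborSet v \ C.neighborSet v := ⟨hb, h.2⟩
  rw [hx] at hax hbx
  exact hab (hax.trans hbx.symm)

lemma permutation_data {V : Type*} [Finite V] {G : SimpleGraph V} (h : IsPermutationGraph G) :
    Even (Nat.card V) ∧ (4 ∣ Nat.card V → Colourable3 G) := by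
  obtain ⟨hG, C₁, C₂, hC1, hC2, i1, i2, hd, hF⟩ := h
  have hs : ∀ v, v ∈ C₁.verts ∨ v ∈ C₂.verts := fun v => by simpa using hF.1 v
  obtain ⟨he, hc⟩ := card_cycles hG C₁ C₂ hC1.2 hC2.2 i1 i2 hd hs
  refine ⟨⟨C₂.verts.ncard, by omega⟩, fun h4 => ?_⟩
  have hev1 : Even C₁.verts.ncard := by rw [Nat.even_iff]; omega
  have hev2 : Even C₂.verts.ncard := by rw [Nat.even_iff]; omega
  obtain ⟨M1, hM1⟩ := exists_alternating C₁ hC1 hev1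
  obtain ⟨M2, hM2⟩ := exists_alternating C₂ hC2 hev2
  refine ⟨fun e => if e ∈ C₁.edgeSet then (if M1 e then 0 else 1) else
    if e ∈ C₂.edgeSet then (if M2 e then 0 else 1) else 2, ?_⟩
  rintro e₁ he₁ e₂ he₂ hne ⟨v, hv1, hv2⟩
  obtain ⟨a, rfl⟩ := Sym2.mem_iff_exists.1 hv1
  obtain ⟨b, rfl⟩ := Sym2.mem_iff_exists.1 hv2
  have hab : a ≠ b := fun h => hne (by rw [h])
  rw [SimpleGraph.mem_edgeSet] at he₁ he₂
  simp only [SimpleGraph.Subgraph.mem_edgeSet]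
  rcases hs v with hv | hv
  · have hno : ∀ x, ¬ C₂.Adj v x := fun x hx => Set.disjoint_left.1 hd hv hx.fst_mem
    have h1 := not_both_off hG C₁ hC1.2 v a b hv he₁ he₂ hab
    have h2 := hM1 v a b
    by_cases ha : C₁.Adj v a <;> by_cases hb : C₁.Adj v b <;> by_cases p : M1 s(v, a) <;>
      by_cases q : M1 s(v, b) <;> simp_all
  · have hno : ∀ x, ¬ C₁.Adj v x := fun x hx => Set.disjoint_left.1 hd hx.fst_mem hv
    have h1 := not_both_off hG C₂ hC2.2 v a b hv he₁ he₂ hab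
    have h2 := hM2 v a b
    by_cases ha : C₂.Adj v a <;> by_cases hb : C₂.Adj v b <;> by_cases p : M2 s(v, a) <;>
      by_cases q : M2 s(v, b) <;> simp_all

/-- every cubic permutation graph whose order is divisible by 4 is colourable;
consequently every permutation snark has order congruent to 2 modulo 4. -/
theorem permutation_graph_order_mod_four :
    (∀ (V : Type) [Fintype V] (G : SimpleGraph V),
      IsPermutationGraph G → 4 ∣ Fintype.card V → Colourable3 G) ∧
    (∀ (V : Type) [Fintype V] (G : SimpleGraph V),
      IsSnark G → IsPermutationGraph G → Fintype.card V % 4 = 2) := by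
  constructor
  · intro V _ G h h4
    exact (permutation_data h).2 (by rwa [Nat.card_eq_fintype_card])
  · intro V _ G hs h
    obtain ⟨⟨k, hk⟩, hcol⟩ := permutation_data h
    have hn : ¬ 4 ∣ Nat.card V := fun h4 => hs.2.1 (hcol h4)
    rw [Nat.card_eq_fintype_card] at hk hn
    omega

end SnarkPaper
end

section
/- Let G be a snark on n vertices containing a cycle of length n − 1 (i.e. a cycle missing exactly one vertex). Then G is not a strong snark: there exists an edge e of G such that G*e is colourable. -/
open scoped Classical

namespace SnarkPaper

variable {V : Type*}

/-- Cyclic indexing of the vertices of a cycle, starting from a given vertex. -/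
theorem exists_index {V : Type*} [Fintype V] {G : SimpleGraph V} (C : G.Subgraph)
    (hC : IsCycleSub C) (b : V) (hb : b ∈ C.verts) :
    ∃ idx : V → ℕ, idx b = 0 ∧ (∀ u ∈ C.verts, idx u < C.verts.ncard) ∧
      (∀ u ∈ C.verts, ∀ t ∈ C.verts, idx u = idx t → u = t) ∧
      (∀ u t, C.Adj u t → idx u + 1 = idx t ∨ idx t + 1 = idx u ∨
        (idx u = 0 ∧ idx t + 1 = C.verts.ncard) ∨ (idx t = 0 ∧ idx u + 1 = C.verts.ncard)) := by
  have hcyc : C.spanningCoe.IsCycles := by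
    rintro v ⟨w, hw⟩
    have h1 : C.Adj v w := by simpa using hw
    have h2 := hC.2 v (C.edge_vert h1)
    have h3 : C.spanningCoe.neighborSet v = C.neighborSet v := by
      ext t; simp
    rw [h3]; exact h2
  have hne : (C.spanningCoe.neighborSet b).Nonempty := by
    have h2 := hC.2 b hb
    have h4 : (C.neighborSet b).Nonempty := by
      apply Set.nonempty_of_ncard_ne_zero; omega
    obtain ⟨w, hw⟩ := h4
    exact ⟨w, by simpa using hw⟩
  obtain ⟨p, hp, hpv⟩ := hcyc.exists_cycle_toSubgraph_verts_eq_connectedComponentSupp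
    (c := C.spanningCoe.connectedComponentMk b) (v := b) rfl hne
  have hsupp : ∀ u, u ∈ p.support ↔ u ∈ C.verts := by
    intro u
    rw [← SimpleGraph.Walk.mem_verts_toSubgraph, hpv, SimpleGraph.ConnectedComponent.mem_supp_iff,
      SimpleGraph.ConnectedComponent.eq]
    constructor
    · intro hr
      by_cases hub : u = b
      · rw [hub]; exact hb
      · obtain ⟨q⟩ := hr
        cases q with
        | nil => exact absurd rfl hub
        | cons h q =>
          exact C.edge_vert (by simpa using h)
    · intro hu
      obtain ⟨q⟩ := hC.1.coe.preconnected ⟨u, hu⟩ ⟨b, hb⟩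
      exact ⟨q.map (⟨Subtype.val, fun {a b} h => by simpa using h⟩ : C.coe →g C.spanningCoe)⟩
  have hget : ∀ u ∈ C.verts, ∃ i, i < p.length ∧ p.getVert i = u := by
    intro u hu
    obtain ⟨n, hn, hnl⟩ := SimpleGraph.Walk.mem_support_iff_exists_getVert.mp ((hsupp u).mpr hu)
    rcases Nat.lt_or_ge n p.length with h | h
    · exact ⟨n, h, hn⟩
    · refine ⟨0, ?_, ?_⟩
      · have := hp.three_le_length; omega
      · have : n = p.length := le_antisymm hnl h
        subst this
        simpa using hn
  have hinj : ∀ i j, i < p.length → j < p.length → p.getVert i = p.getVert j → i = j := by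
    intro i j hi hj h
    exact hp.getVert_injOn' (by simp only [Set.mem_ofPred_eq]; omega)
      (by simp only [Set.mem_ofPred_eq]; omega) h
  have hcard : C.verts.ncard = p.length := by
    have : C.verts = p.getVert '' (Set.Iio p.length) := by
      ext u
      constructor
      · intro hu
        obtain ⟨i, hi, h⟩ := hget u hu
        exact ⟨i, hi, h⟩
      · rintro ⟨i, hi, rfl⟩
        exact (hsupp _).mp (p.getVert_mem_support i)
    rw [this, Set.InjOn.ncard_image]
    · simp [Set.ncard_eq_toFinset_card']
    · intro i hi j hj h
      exact hinj i j hi hj h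
  choose! idx hidx1 hidx2 using hget
  have hidx3 : ∀ i, i < p.length → idx (p.getVert i) = i := by
    intro i hi
    have hm := (hsupp _).mp (p.getVert_mem_support i)
    exact hinj _ _ (hidx1 _ hm) hi (hidx2 _ hm)
  have h3 := hp.three_le_length
  have hb0 : idx b = 0 := by
    have := hidx3 0 (by omega)
    simpa using this
  refine ⟨idx, hb0, ?_, ?_, ?_⟩
  · intro u hu; rw [hcard]; exact hidx1 u hu
  · intro u hu t ht h
    rw [← hidx2 u hu, ← hidx2 t ht, h]
  · intro u t hut
    have hmem : u ∈ p.toSubgraph.verts := by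
      rw [SimpleGraph.Walk.mem_verts_toSubgraph, hsupp]; exact C.edge_vert hut
    have hadj : p.toSubgraph.Adj u t := by
      rw [hp.adj_toSubgraph_iff_of_isCycles hcyc hmem]; simpa using hut
    rw [SimpleGraph.Walk.toSubgraph_adj_iff] at hadj
    obtain ⟨i, hi, hil⟩ := hadj
    rw [hcard]
    have e1 := hidx3 i hil
    have e2 : idx (p.getVert (i+1)) = i + 1 ∨ (idx (p.getVert (i+1)) = 0 ∧ i + 1 = p.length) := by
      rcases Nat.lt_or_ge (i+1) p.length with h | h
      · exact Or.inl (hidx3 _ h)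
      · right
        have : i + 1 = p.length := by omega
        rw [this]
        simp [hb0]
    rw [Sym2.eq_iff] at hi
    rcases hi with ⟨h1, h2⟩ | ⟨h1, h2⟩ <;> rw [h1] at e1 <;> rw [h2] at e2 <;> omega

/-- a snark on n vertices with a cycle of length n - 1 is not strong: some
edge e has G*e (delete e and suppress the two degree-2 vertices) colourable. -/
theorem not_strong_of_near_hamiltonian_cycle {V : Type*} [Fintype V]
    (G : SimpleGraph V) (hG : IsSnark G)
    (C : G.Subgraph) (hC : IsCycleSub C)
    (hlen : C.verts.ncard + 1 = Fintype.card V) :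
    ∃ a b : V, G.Adj a b ∧
      ∀ x y z w : V, x ≠ y → z ≠ w →
        G.neighborSet a = {b, x, y} → G.neighborSet b = {a, z, w} →
        Colourable3 (SimpleGraph.fromEdgeSet
          ({e ∈ G.edgeSet | a ∉ e ∧ b ∉ e} ∪ {s(x, y), s(z, w)})) := by
  have hcub := hG.1
  have hcard : Even (Fintype.card V) := by
    have hreg : G.IsRegularOfDegree 3 := by
      intro v
      have := hcub v
      rw [Set.ncard_eq_toFinset_card'] at this
      simpa [SimpleGraph.degree, SimpleGraph.neighborFinset] using this
    have h1 := G.sum_degrees_eq_twice_card_edges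
    simp only [hreg.degree_eq, Finset.sum_const, Finset.card_univ, smul_eq_mul] at h1
    rw [Nat.even_iff]; omega
  obtain ⟨v, hv⟩ : ∃ v, C.vertsᶜ = {v} := by
    rw [← Set.ncard_eq_one]
    have := Set.ncard_add_ncard_compl C.verts
    rw [Nat.card_eq_fintype_card] at this
    omega
  have hmem : ∀ u, u ∈ C.verts ↔ u ≠ v := by
    intro u
    have : u ∈ C.vertsᶜ ↔ u = v := by rw [hv]; simp
    rw [Set.mem_compl_iff] at this
    tauto
  have hthird : ∀ u, u ≠ v → ∃ k, ∀ t, G.Adj u t → ¬ C.Adj u t → t = k := by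
    intro u hu
    have h2 := hC.2 u ((hmem u).mpr hu)
    have h3 := hcub u
    have hsub : C.neighborSet u ⊆ G.neighborSet u := C.neighborSet_subset u
    have h4 := Set.ncard_sdiff hsub
    rw [h2, h3] at h4
    obtain ⟨k, hk⟩ := Set.ncard_eq_one.mp h4
    refine ⟨k, fun t h5 h6 => ?_⟩
    have : t ∈ G.neighborSet u \ C.neighborSet u := ⟨h5, h6⟩
    rw [hk] at this
    exact this
  obtain ⟨b, hb⟩ : (G.neighborSet v).Nonempty := by
    apply Set.nonempty_of_ncard_ne_zero
    rw [hcub v]; omega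
  have hvb : G.Adj v b := hb
  refine ⟨v, b, hvb, ?_⟩
  intro x y z w hxy hzw hNv hNb
  obtain ⟨idx, hidx0, hlt, hinj, hadj⟩ := exists_index C hC b ((hmem b).mpr hvb.ne')
  have hNv' : ∀ t, G.Adj v t ↔ t = b ∨ t = x ∨ t = y := by
    intro t
    rw [← SimpleGraph.mem_neighborSet, hNv]; simp
  have hNb' : ∀ t, G.Adj b t ↔ t = v ∨ t = z ∨ t = w := by
    intro t
    rw [← SimpleGraph.mem_neighborSet, hNb]; simp
  have hdist : ∀ p q r : V, ({p, q, r} : Set V).ncard = 3 → p ≠ q ∧ p ≠ r := by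
    intro p q r h
    constructor
    · rintro rfl
      have := Set.ncard_insert_le p {r}
      rw [Set.ncard_singleton] at this
      simp at h
      omega
    · rintro rfl
      have h5 : ({p, q, p} : Set V) = {q, p} := by ext; simp
      have := Set.ncard_insert_le q {p}
      rw [Set.ncard_singleton] at this
      rw [h5] at h
      omega
  obtain ⟨hbx, hby⟩ := hdist b x y (by rw [← hNv]; exact hcub v)
  obtain ⟨hvz, hvw⟩ := hdist v z w (by rw [← hNb]; exact hcub b)
  have hCv : ∀ u t, C.Adj u t → u ≠ v ∧ t ≠ v := fun u t h =>
    ⟨(hmem u).mp (C.edge_vert h), (hmem t).mp (C.edge_vert h.symm)⟩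
  have hvx : G.Adj v x := (hNv' x).mpr (by simp)
  have hvy : G.Adj v y := (hNv' y).mpr (by simp)
  have hbz : G.Adj b z := (hNb' z).mpr (by simp)
  have hbw : G.Adj b w := (hNb' w).mpr (by simp)
  have hCb : ∀ t, G.Adj b t → t ≠ v → C.Adj b t := by
    obtain ⟨k, hk⟩ := hthird b hvb.ne'
    have hkv := hk v hvb.symm (fun h => (hCv _ _ h).2 rfl)
    intro t ht htv
    by_contra hcon
    exact htv ((hk t ht hcon).trans hkv.symm)
  have hCz := hCb z hbz hvz.symm
  have hCw := hCb w hbw hvw.symm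
  have hCbzw : ∀ t, C.Adj b t → t = z ∨ t = w := by
    intro t ht
    have := (hNb' t).mp ht.adj_sub
    have h2 := (hCv _ _ ht).2
    tauto
  have hidx_ne : ∀ t, t ≠ v → t ≠ b → idx t ≠ 0 := by
    intro t htv htb h0
    exact htb (hinj _ ((hmem _).mpr htv) _ ((hmem _).mpr hvb.ne') (by omega))
  have hzi := hadj b z hCz
  have hwi := hadj b w hCw
  have hzne := hidx_ne z hvz.symm hbz.ne'
  have hwne := hidx_ne w hvw.symm hbw.ne'
  have hziwi : idx z ≠ idx w := fun h =>
    hzw (hinj _ ((hmem _).mpr hvz.symm) _ ((hmem _).mpr hvw.symm) h)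
  let c : Sym2 V → Fin 3 := fun e =>
    if e = s(z, w) then 0 else if e ∈ C.edgeSet then
      (if ∃ u t, e = s(u, t) ∧ idx u + 1 = idx t ∧ Odd (idx u) then 1 else 0) else 2
  have hc : ∀ u t, c s(u, t) = if (u = z ∧ t = w ∨ u = w ∧ t = z) then 0 else
      if C.Adj u t then (if (idx u + 1 = idx t ∧ Odd (idx u)) ∨ (idx t + 1 = idx u ∧ Odd (idx t))
        then 1 else 0) else 2 := by
    intro u t
    have h1 : (∃ u' t', s(u, t) = s(u', t') ∧ idx u' + 1 = idx t' ∧ Odd (idx u')) ↔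
        ((idx u + 1 = idx t ∧ Odd (idx u)) ∨ (idx t + 1 = idx u ∧ Odd (idx t))) := by
      constructor
      · rintro ⟨u', t', h, h2⟩
        rw [Sym2.eq_iff] at h
        rcases h with ⟨rfl, rfl⟩ | ⟨rfl, rfl⟩
        · exact Or.inl h2
        · exact Or.inr h2
      · rintro (h | h)
        · exact ⟨u, t, rfl, h⟩
        · exact ⟨t, u, Sym2.eq_swap, h⟩
    simp only [c, h1]
    simp only [Sym2.eq_iff, SimpleGraph.Subgraph.mem_edgeSet]
  clear_value c
  have hH : ∀ u t, (SimpleGraph.fromEdgeSet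
      ({e ∈ G.edgeSet | v ∉ e ∧ b ∉ e} ∪ {s(x, y), s(z, w)})).Adj u t →
      u ≠ v ∧ u ≠ b ∧ t ≠ v ∧ t ≠ b ∧ u ≠ t ∧ (G.Adj u t ∨ (u = x ∧ t = y ∨ u = y ∧ t = x) ∨
        (u = z ∧ t = w ∨ u = w ∧ t = z)) := by
    intro u t h
    simp only [SimpleGraph.fromEdgeSet_adj, Set.mem_union, Set.mem_sep_iff, Set.mem_insert_iff,
      Set.mem_singleton_iff, SimpleGraph.mem_edgeSet, Sym2.mem_iff, Sym2.eq_iff] at h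
    have := hvx.ne
    have := hvy.ne
    have := hbz.ne
    have := hbw.ne
    grind
  have key : ∀ u t₁ t₂, (SimpleGraph.fromEdgeSet
      ({e ∈ G.edgeSet | v ∉ e ∧ b ∉ e} ∪ {s(x, y), s(z, w)})).Adj u t₁ →
      (SimpleGraph.fromEdgeSet
      ({e ∈ G.edgeSet | v ∉ e ∧ b ∉ e} ∪ {s(x, y), s(z, w)})).Adj u t₂ →
      c s(u, t₁) = c s(u, t₂) → t₁ = t₂ := by
    intro u t₁ t₂ h1 h2 hcc
    obtain ⟨huv, hub, h1v, h1b, hu1, h1'⟩ := hH _ _ h1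
    obtain ⟨-, -, h2v, h2b, hu2, h2'⟩ := hH _ _ h2
    by_cases hcol : c s(u, t₁) = 2
    · have hcol2 := hcc ▸ hcol
      have hnot : ∀ t, c s(u, t) = 2 →
          ¬ (u = z ∧ t = w ∨ u = w ∧ t = z) ∧ ¬ C.Adj u t := by
        intro t ht
        rw [hc] at ht
        split_ifs at ht with g1 g2 g3
        · exact absurd ht (by decide)
        · exact absurd ht (by decide)
        · exact absurd ht (by decide)
        · exact ⟨g1, g2⟩
      obtain ⟨n1, m1⟩ := hnot _ hcol
      obtain ⟨n2, m2⟩ := hnot _ hcol2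
      obtain ⟨k, hk⟩ := hthird u huv
      have hux : u = x ∨ u = y → k = v := by
        intro h
        refine (hk v ?_ (fun h => (hCv _ _ h).2 rfl)).symm
        rcases h with rfl | rfl
        · exact hvx.symm
        · exact hvy.symm
      have k1 := hk t₁
      have k2 := hk t₂
      clear hc hadj hinj hlt hidx0 hcol hcol2 hcc hH h1 h2 hnot
      grind
    · have hP : ∀ t, t ≠ v → t ≠ b → c s(u, t) ≠ 2 →
          (c s(u, t) = 0 ∧ ((idx u = 1 ∧ idx t + 1 = C.verts.ncard ∨
              idx t = 1 ∧ idx u + 1 = C.verts.ncard) ∨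
              (idx u + 1 = idx t ∧ idx u % 2 = 0 ∨ idx t + 1 = idx u ∧ idx t % 2 = 0))) ∨
          (c s(u, t) = 1 ∧
            (idx u + 1 = idx t ∧ idx u % 2 = 1 ∨ idx t + 1 = idx u ∧ idx t % 2 = 1)) := by
        intro t htv htb ht
        rw [hc] at ht ⊢
        split_ifs at ht ⊢ with g1 g2 g3
        · left
          refine ⟨rfl, Or.inl ?_⟩
          rcases g1 with ⟨rfl, rfl⟩ | ⟨rfl, rfl⟩ <;> omega
        · right
          simp only [Nat.odd_iff] at g3
          exact ⟨rfl, g3⟩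
        · left
          refine ⟨rfl, ?_⟩
          have := hadj u t g2
          have := hidx_ne u huv hub
          have : idx t ≠ 0 := by
            intro h0
            exact hidx_ne t htv htb h0
          simp only [Nat.odd_iff] at g3
          omega
        · exact absurd rfl ht
      have p1 := hP _ h1v h1b hcol
      have p2 := hP _ h2v h2b (hcc ▸ hcol)
      rw [← hcc] at p2
      apply hinj _ ((hmem _).mpr h1v) _ ((hmem _).mpr h2v)
      have i1 := hidx_ne _ h1v h1b
      have i2 := hidx_ne _ h2v h2b
      have i3 := hidx_ne _ huv hub
      have l1 := hlt _ ((hmem _).mpr h1v)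
      have l2 := hlt _ ((hmem _).mpr h2v)
      rw [Nat.even_iff] at hcard
      rcases p1 with ⟨q1, p1⟩ | ⟨q1, p1⟩ <;> rcases p2 with ⟨q2, p2⟩ | ⟨q2, p2⟩
      · omega
      · rw [q1] at q2; exact absurd q2 (by decide)
      · rw [q1] at q2; exact absurd q2 (by decide)
      · omega
  refine ⟨c, ?_⟩
  intro e₁ he₁ e₂ he₂ hne ⟨u, hu1, hu2⟩ hcc
  obtain ⟨t₁, rfl⟩ := Sym2.mem_iff_exists.mp hu1
  obtain ⟨t₂, rfl⟩ := Sym2.mem_iff_exists.mp hu2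
  exact hne (by rw [key u t₁ t₂ he₁ he₂ hcc])

end SnarkPaper
end

section
/- Let G be a connected cubic graph with a proper 5-edge-colouring c in which every edge is poor. Then c uses only three colours; in particular G is colourable. -/
open scoped Classical

namespace SnarkPaper

variable {V : Type*}

/-- a connected cubic graph with a proper 5-edge-colouring in which every edge
is poor uses only three colours; in particular it is colourable. -/
theorem all_poor_implies_three_colours {V : Type*} [Fintype V]
    (G : SimpleGraph V) (hG : IsCubic G) (hconn : G.Connected)
    (c : Sym2 V → Fin 5)
    (hproper : ∀ e₁ ∈ G.edgeSet, ∀ e₂ ∈ G.edgeSet,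
      e₁ ≠ e₂ → (∃ v, v ∈ e₁ ∧ v ∈ e₂) → c e₁ ≠ c e₂)
    (hpoor : ∀ u v : V, G.Adj u v →
      {k : Fin 5 | ∃ f ∈ G.edgeSet, (u ∈ f ∨ v ∈ f) ∧ c f = k}.ncard = 3) :
    {k : Fin 5 | ∃ e ∈ G.edgeSet, c e = k}.ncard ≤ 3 ∧ Colourable3 G := by
  have key : ∀ v, (Set.image (fun w => c s(v, w)) (G.neighborSet v)).ncard = 3 := by
    intro v
    rw [Set.ncard_image_of_injOn, hG v]
    intro a ha b hb hab
    by_contra hne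
    refine hproper s(v, a) ha s(v, b) hb ?_ ⟨v, by simp, by simp⟩ hab
    intro h
    exact hne (Sym2.congr_right.mp h)
  have hsub : ∀ u v, G.Adj u v →
      (Set.image (fun w => c s(u, w)) (G.neighborSet u)) = (Set.image (fun w => c s(v, w)) (G.neighborSet v)) := by
    intro u v huv
    have h1 : (Set.image (fun w => c s(u, w)) (G.neighborSet u)) =
        {k : Fin 5 | ∃ f ∈ G.edgeSet, (u ∈ f ∨ v ∈ f) ∧ c f = k} := by
      apply Set.eq_of_subset_of_ncard_le
      · rintro k ⟨w, hw, rfl⟩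
        exact ⟨s(u, w), hw, Or.inl (by simp), rfl⟩
      · rw [hpoor u v huv, key u]
      · exact Set.toFinite _
    have h2 : (Set.image (fun w => c s(v, w)) (G.neighborSet v)) =
        {k : Fin 5 | ∃ f ∈ G.edgeSet, (u ∈ f ∨ v ∈ f) ∧ c f = k} := by
      apply Set.eq_of_subset_of_ncard_le
      · rintro k ⟨w, hw, rfl⟩
        exact ⟨s(v, w), hw, Or.inr (by simp), rfl⟩
      · rw [hpoor u v huv, key v]
      · exact Set.toFinite _
    rw [h1, h2]
  obtain ⟨v0⟩ := hconn.nonempty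
  have hall : ∀ v, (Set.image (fun w => c s(v, w)) (G.neighborSet v)) =
      (Set.image (fun w => c s(v0, w)) (G.neighborSet v0)) := by
    intro v
    obtain ⟨p⟩ := hconn.preconnected v v0
    induction p with
    | nil => rfl
    | cons h _ ih => exact (hsub _ _ h).trans ih
  have hmem : ∀ e ∈ G.edgeSet, c e ∈ (Set.image (fun w => c s(v0, w)) (G.neighborSet v0)) := by
    intro e
    induction e with
    | _ x y =>
      intro he
      rw [← hall x]
      exact ⟨y, he, rfl⟩
  have h3 := key v0
  generalize (Set.image (fun w => c s(v0, w)) (G.neighborSet v0)) = S at hmem h3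
  constructor
  · rw [← h3]
    apply Set.ncard_le_ncard _ (Set.toFinite _)
    rintro k ⟨e, he, rfl⟩
    exact hmem e he
  · have hc : Nat.card S = 3 := h3
    let φ : S ≃ Fin 3 := Finite.equivFinOfCardEq hc
    refine ⟨fun e => if h : c e ∈ S then φ ⟨c e, h⟩ else 0, ?_⟩
    intro e₁ h₁ e₂ h₂ hne hv heq
    simp only [hmem e₁ h₁, hmem e₂ h₂, dif_pos] at heq
    exact hproper e₁ h₁ e₂ h₂ hne hv (congrArg Subtype.val (φ.injective heq))


end SnarkPaper
end

section
/- There exists a cyclically 5-edge-connected permutation snark on 34 vertices. In particular, the conjecture of Zhang that the Petersen graph (which has 10 vertices) is the only cyclically 5-edge-connected cubic permutation graph that is a snark is false. -/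
open scoped Classical

namespace SnarkPaper

variable {V : Type*}

/-! ### The graph: two 17-cycles joined by a permutation, adjacency rows as bit masks -/

/-- Row `v` has bit `w` set when `v` and `w` are adjacent. -/
def rowMasks : List ℕ :=
  [196610, 1048581, 268435466, 67108884, 8589934632, 134217808, 4194464, 524608, 2097792,
   1073743104, 4294969856, 536876032, 16787456, 282624, 33595392, 8470528, 2147516417,
   8590196737, 663552, 1310848, 2621442, 5243136, 10485824, 21004288, 41947136, 83902464,
   167772168, 335544352, 671088644, 1342179328, 2684355072, 5368774656, 10737419264, 4295098384]

/-- Boolean adjacency. -/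
def adjB (u v : Fin 34) : Bool := Nat.testBit (rowMasks.getD u.val 0) v.val

theorem adjB_symm : ∀ u v : Fin 34, adjB u v = true → adjB v u = true := by decide +kernel

theorem adjB_irrefl : ∀ u : Fin 34, ¬ (adjB u u = true) := by decide +kernel

/-- The permutation snark. -/
def theG : SimpleGraph (Fin 34) where
  Adj u v := adjB u v = true
  symm := ⟨fun u v h => adjB_symm u v h⟩
  loopless := ⟨fun u h => adjB_irrefl u h⟩

theorem theG_adj (u v : Fin 34) : theG.Adj u v ↔ adjB u v = true := Iff.rfl

theorem ncard_of_filter (S : Set (Fin 34)) (b : Fin 34 → Bool) (n : ℕ)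
    (hS : ∀ w, w ∈ S ↔ b w = true)
    (hn : ((List.finRange 34).filter b).length = n) : S.ncard = n := by
  have h : S = (((List.finRange 34).filter b).toFinset : Set (Fin 34)) := by
    ext w
    simp [hS]
  rw [h, Set.ncard_coe_finset, List.toFinset_card_of_nodup, hn]
  exact (List.nodup_finRange 34).filter _

theorem theG_cubic : IsCubic theG := by
  intro v
  refine ncard_of_filter _ (fun w => adjB v w) 3 (fun w => Iff.rfl) ?_
  revert v
  decide +kernel

/-! ### Uncolourability -/

/-- Bit mask of an edge. -/
def emask (e : Fin 34 × Fin 34) : ℕ := 2 ^ e.1.val ||| 2 ^ e.2.val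

/-- Backtracking search for a 3-edge-colouring; the state holds, for each colour, the mask of
the vertices already covered by that colour. -/
def colSearch : List (Fin 34 × Fin 34) → ℕ → ℕ → ℕ → Bool
  | [], _, _, _ => true
  | e :: t, a, b, c =>
    (Nat.beq (Nat.land a (emask e)) 0 && colSearch t (Nat.lor a (emask e)) b c) ||
    ((Nat.beq (Nat.land b (emask e)) 0 && colSearch t a (Nat.lor b (emask e)) c) ||
    (Nat.beq (Nat.land c (emask e)) 0 && colSearch t a b (Nat.lor c (emask e))))

/-- The edges in a good order for the search. -/
def edgeOrder : List (Fin 34 × Fin 34) :=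
  [(11, 12), (11, 29), (10, 11), (10, 32), (9, 10), (12, 24), (12, 13), (8, 9), (9, 30),
   (29, 30), (30, 31), (28, 29), (31, 32), (16, 31), (32, 33), (23, 24), (24, 25), (13, 18),
   (13, 14), (14, 25), (14, 15), (25, 26), (15, 16), (15, 23), (0, 16), (22, 23), (21, 22),
   (6, 22), (8, 21), (20, 21), (7, 8), (6, 7), (7, 19), (5, 6), (19, 20), (18, 19), (17, 18),
   (1, 20), (0, 1), (0, 17), (17, 33), (4, 33), (1, 2), (2, 28), (27, 28), (2, 3), (3, 4),
   (4, 5), (3, 26), (26, 27), (5, 27)]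

theorem lor_land_zero (a m k : ℕ) (h1 : a &&& k = 0) (h2 : m &&& k = 0) :
    Nat.lor a m &&& k = 0 := by
  change (a ||| m) &&& k = 0
  rw [Nat.and_or_distrib_right, h1, h2]
  rfl

theorem colSearch_complete (col : Fin 34 × Fin 34 → Fin 3) :
    ∀ (es : List (Fin 34 × Fin 34)) (a b c : ℕ),
      es.Pairwise (fun e e' => col e = col e' → emask e &&& emask e' = 0) →
      (∀ e ∈ es, col e = 0 → a &&& emask e = 0) →
      (∀ e ∈ es, col e = 1 → b &&& emask e = 0) →
      (∀ e ∈ es, col e = 2 → c &&& emask e = 0) →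
      colSearch es a b c = true := by
  intro es
  induction es with
  | nil => intros; rfl
  | cons e t ih =>
    intro a b c hp ha hb hc
    rw [List.pairwise_cons] at hp
    obtain ⟨hp1, hp2⟩ := hp
    have ha' : ∀ x ∈ t, col x = 0 → a &&& emask x = 0 :=
      fun x hx => ha x (List.mem_cons_of_mem _ hx)
    have hb' : ∀ x ∈ t, col x = 1 → b &&& emask x = 0 :=
      fun x hx => hb x (List.mem_cons_of_mem _ hx)
    have hc' : ∀ x ∈ t, col x = 2 → c &&& emask x = 0 :=
      fun x hx => hc x (List.mem_cons_of_mem _ hx)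
    have h3 : col e = 0 ∨ col e = 1 ∨ col e = 2 := by
      generalize col e = k
      revert k
      decide
    rw [colSearch, Bool.or_eq_true, Bool.or_eq_true, Bool.and_eq_true, Bool.and_eq_true,
      Bool.and_eq_true]
    rcases h3 with h | h | h
    · left
      refine ⟨Nat.beq_eq.mpr (ha e List.mem_cons_self h), ?_⟩
      exact ih _ _ _ hp2 (fun x hx hx0 => lor_land_zero _ _ _ (ha' x hx hx0)
        (hp1 x hx (h.trans hx0.symm))) hb' hc'
    · right; left
      refine ⟨Nat.beq_eq.mpr (hb e List.mem_cons_self h), ?_⟩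
      exact ih _ _ _ hp2 ha' (fun x hx hx0 => lor_land_zero _ _ _ (hb' x hx hx0)
        (hp1 x hx (h.trans hx0.symm))) hc'
    · right; right
      refine ⟨Nat.beq_eq.mpr (hc e List.mem_cons_self h), ?_⟩
      exact ih _ _ _ hp2 ha' hb' (fun x hx hx0 => lor_land_zero _ _ _ (hc' x hx hx0)
        (hp1 x hx (h.trans hx0.symm)))

/-- Two edges are distinct. -/
def edgeNe (e e' : Fin 34 × Fin 34) : Bool :=
  !((e.1 == e'.1 && e.2 == e'.2) || (e.1 == e'.2 && e.2 == e'.1))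

theorem edgeNe_spec (e e' : Fin 34 × Fin 34) (h : edgeNe e e' = true) :
    s(e.1, e.2) ≠ s(e'.1, e'.2) := by
  intro heq
  rw [Sym2.eq_iff] at heq
  simp only [edgeNe, Bool.not_eq_true', Bool.or_eq_false_iff, Bool.and_eq_false_iff,
    beq_eq_false_iff_ne] at h
  tauto

/-- Pair of edges with disjoint masks, or else distinct edges with a common end. -/
def edgeRel (e e' : Fin 34 × Fin 34) : Bool :=
  Nat.beq (emask e &&& emask e') 0 ||
    (edgeNe e e' && (e.1 == e'.1 || e.1 == e'.2 || e.2 == e'.1 || e.2 == e'.2))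

/-- Boolean pairwise test. -/
def pairB (r : Fin 34 × Fin 34 → Fin 34 × Fin 34 → Bool) : List (Fin 34 × Fin 34) → Bool
  | [] => true
  | e :: t => t.all (r e) && pairB r t

theorem pairB_spec (r : Fin 34 × Fin 34 → Fin 34 × Fin 34 → Bool)
    (l : List (Fin 34 × Fin 34)) (h : pairB r l = true) :
    l.Pairwise (fun e e' => r e e' = true) := by
  induction l with
  | nil => exact List.Pairwise.nil
  | cons e t ih =>
    rw [pairB, Bool.and_eq_true, List.all_eq_true] at h
    exact List.Pairwise.cons h.1 (ih h.2)

theorem edgeOrder_adj : edgeOrder.all (fun e => adjB e.1 e.2) = true := by decide +kernel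

theorem edgeOrder_pair : pairB edgeRel edgeOrder = true := by decide +kernel

theorem edgeOrder_search : colSearch edgeOrder 0 0 0 = false := by decide +kernel

theorem theG_uncol : ¬ Colourable3 theG := by
  rintro ⟨c, hc⟩
  have hadj := List.all_eq_true.mp edgeOrder_adj
  have key := colSearch_complete (fun e => c s(e.1, e.2)) edgeOrder 0 0 0 ?_
    (fun e _ _ => Nat.zero_and _) (fun e _ _ => Nat.zero_and _) (fun e _ _ => Nat.zero_and _)
  · rw [edgeOrder_search] at key
    exact Bool.false_ne_true key
  · refine (pairB_spec _ _ edgeOrder_pair).imp_of_mem ?_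
    intro e e' he he' hr hcol
    by_contra hne
    rw [edgeRel, Bool.or_eq_true, Bool.and_eq_true] at hr
    rcases hr with hr | ⟨hr1, hr2⟩
    · exact hne (Nat.eq_of_beq_eq_true hr)
    · refine hc s(e.1, e.2) (hadj e he) s(e'.1, e'.2) (hadj e' he') (edgeNe_spec _ _ hr1) ?_ hcol
      simp only [Bool.or_eq_true, beq_iff_eq] at hr2
      rcases hr2 with ((h | h) | h) | h
      · exact ⟨e.1, by simp, by simp [h]⟩
      · exact ⟨e.1, by simp, by simp [h]⟩
      · exact ⟨e.2, by simp, by simp [h]⟩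
      · exact ⟨e.2, by simp, by simp [h]⟩

/-! ### Cyclic edge-connectivity -/

/-- Number of listed vertices whose bit is set in the mask. -/
def hits (m : ℕ) : List (Fin 34) → ℕ
  | [] => 0
  | w :: t => bif Nat.testBit m w.val then hits m t + 1 else hits m t

/-- Search over all vertex sets: `a` and `b` are the masks of the vertices put inside and outside,
`k` the number of cut edges so far and `z` the number of vertices inside. Returns true when every
set with at most four cut edges has at most two vertices inside or at most two outside. -/
def cutSearch : List (Fin 34 × List (Fin 34)) → ℕ → ℕ → ℕ → ℕ → Bool
  | [], _, _, _, z => Nat.ble z 2 || Nat.ble 32 z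
  | p :: t, a, b, k, z =>
    (Nat.ble 5 (k + hits b p.2) ||
      cutSearch t (Nat.lor a (2 ^ p.1.val)) b (k + hits b p.2) (z + 1)) &&
    (Nat.ble 5 (k + hits a p.2) ||
      cutSearch t a (Nat.lor b (2 ^ p.1.val)) (k + hits a p.2) z)

/-- Vertices in a good order, each with its earlier neighbours. -/
def cutOrder : List (Fin 34 × List (Fin 34)) :=
  [(23, []), (22, [23]), (21, [22]), (6, [22]), (24, [23]), (8, [21]), (7, [6, 8]),
   (12, [24]), (15, [23]), (13, [12]), (14, [13, 15]), (25, [14, 24]), (19, [7]),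
   (20, [19, 21]), (18, [13, 19]), (16, [15]), (17, [18]), (0, [16, 17]), (1, [0, 20]),
   (33, [17]), (5, [6]), (4, [5, 33]), (3, [4]), (2, [1, 3]), (26, [3, 25]), (27, [5, 26]),
   (28, [2, 27]), (29, [28]), (11, [12, 29]), (30, [29]), (31, [16, 30]), (9, [8, 30]),
   (10, [9, 11]), (32, [10, 31, 33])]

theorem cutOrder_search : cutSearch cutOrder 0 0 0 0 = true := by decide +kernel

/-- Number of vertices in `ns` on the other side from `v`. -/
def crossCount (f : Fin 34 → Bool) (v : Fin 34) (ns : List (Fin 34)) : ℕ :=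
  (ns.filter (fun w => f v != f w)).length

/-- Total number of crossing edges. -/
def crossTotal (f : Fin 34 → Bool) : List (Fin 34 × List (Fin 34)) → ℕ
  | [] => 0
  | p :: t => crossCount f p.1 p.2 + crossTotal f t

theorem hits_le (f : Fin 34 → Bool) (v : Fin 34) (m : ℕ)
    (h : ∀ w : Fin 34, Nat.testBit m w.val = true → f w = !(f v)) (ns : List (Fin 34)) :
    hits m ns ≤ crossCount f v ns := by
  induction ns with
  | nil => exact le_rfl
  | cons w t ih =>
    unfold crossCount at ih ⊢
    rw [hits, List.filter_cons]
    cases hb : Nat.testBit m w.val with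
    | true =>
      have hne : (f v != f w) = true := by
        rw [h w hb]
        cases f v <;> rfl
      rw [if_pos hne, List.length_cons, cond_true]
      omega
    | false =>
      simp only [cond_false]
      split
      · rw [List.length_cons]; omega
      · exact ih

theorem testBit_lor_pow (a : ℕ) (v w : Fin 34)
    (h : Nat.testBit (Nat.lor a (2 ^ v.val)) w.val = true) :
    Nat.testBit a w.val = true ∨ w = v := by
  change Nat.testBit (a ||| 2 ^ v.val) w.val = true at h
  rw [Nat.testBit_or, Bool.or_eq_true, Nat.testBit_two_pow] at h
  rcases h with h | h
  · exact Or.inl h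
  · exact Or.inr (Fin.ext (of_decide_eq_true h).symm)

theorem cutSearch_sound (f : Fin 34 → Bool) :
    ∀ (l : List (Fin 34 × List (Fin 34))) (a b k z : ℕ),
      (∀ w : Fin 34, Nat.testBit a w.val = true → f w = true) →
      (∀ w : Fin 34, Nat.testBit b w.val = true → f w = false) →
      cutSearch l a b k z = true → k + crossTotal f l ≤ 4 →
      z + ((l.map Prod.fst).filter f).length ≤ 2 ∨
        32 ≤ z + ((l.map Prod.fst).filter f).length := by
  intro l
  induction l with
  | nil =>
    intro a b k z _ _ h _
    rw [cutSearch, Bool.or_eq_true] at h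
    rcases h with h | h
    · exact Or.inl (Nat.le_of_ble_eq_true h)
    · exact Or.inr (Nat.le_of_ble_eq_true h)
  | cons p t ih =>
    intro a b k z ha hb h hk
    rw [cutSearch, Bool.and_eq_true, Bool.or_eq_true, Bool.or_eq_true] at h
    rw [crossTotal] at hk
    rw [List.map_cons, List.filter_cons]
    cases hf : f p.1 with
    | true =>
      have hle : hits b p.2 ≤ crossCount f p.1 p.2 :=
        hits_le f p.1 b (fun w hw => by rw [hf, hb w hw]; rfl) p.2
      rcases h.1 with h1 | h1
      · have := Nat.le_of_ble_eq_true h1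
        omega
      · have := ih _ _ _ _ (fun w hw => ?_) hb h1 (by omega)
        · simp only [if_true, List.length_cons]
          omega
        · rcases testBit_lor_pow _ _ _ hw with h2 | h2
          · exact ha w h2
          · rw [h2, hf]
    | false =>
      have hle : hits a p.2 ≤ crossCount f p.1 p.2 :=
        hits_le f p.1 a (fun w hw => by rw [hf, ha w hw]; rfl) p.2
      rcases h.2 with h1 | h1
      · have := Nat.le_of_ble_eq_true h1
        omega
      · have := ih _ _ _ _ ha (fun w hw => ?_) h1 (by omega)
        · simpa using this
        · rcases testBit_lor_pow _ _ _ hw with h2 | h2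
          · exact hb w h2
          · rw [h2, hf]

/-- The edges listed by a cut order. -/
def listEdges : List (Fin 34 × List (Fin 34)) → List (Fin 34 × Fin 34)
  | [] => []
  | p :: t => p.2.map (fun w => (p.1, w)) ++ listEdges t

theorem crossTotal_eq (f : Fin 34 → Bool) (l : List (Fin 34 × List (Fin 34))) :
    crossTotal f l = ((listEdges l).filter (fun e => f e.1 != f e.2)).length := by
  induction l with
  | nil => rfl
  | cons p t ih =>
    rw [crossTotal, listEdges, List.filter_append, List.length_append, ih, List.filter_map,
      List.length_map]
    rfl

theorem cutOrder_adj : (listEdges cutOrder).all (fun e => adjB e.1 e.2) = true := by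
  decide +kernel

theorem cutOrder_pair : pairB edgeNe (listEdges cutOrder) = true := by decide +kernel

theorem cutOrder_all : ∀ v : Fin 34, (cutOrder.map Prod.fst).contains v = true := by
  decide +kernel

theorem cutOrder_length : (cutOrder.map Prod.fst).length = 34 := by decide +kernel

theorem crossTotal_le (A : Set (Fin 34)) (f : Fin 34 → Bool)
    (hf : ∀ v, f v = true ↔ v ∈ A) :
    crossTotal f cutOrder ≤ (cutEdges theG A).ncard := by
  rw [crossTotal_eq]
  set l := (listEdges cutOrder).filter (fun e => f e.1 != f e.2) with hl
  have hnd : (l.map (fun e => s(e.1, e.2))).Nodup := by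
    rw [List.Nodup, List.pairwise_map]
    exact ((pairB_spec _ _ cutOrder_pair).imp (fun {a b} h => edgeNe_spec a b h)).filter _
  rw [← List.length_map (f := fun e : Fin 34 × Fin 34 => s(e.1, e.2)),
    ← List.toFinset_card_of_nodup hnd, ← Set.ncard_coe_finset]
  refine Set.ncard_le_ncard ?_ (Set.toFinite _)
  intro x hx
  rw [Finset.mem_coe, List.mem_toFinset, List.mem_map] at hx
  obtain ⟨e, he, rfl⟩ := hx
  rw [hl, List.mem_filter] at he
  obtain ⟨he1, he2⟩ := he
  refine ⟨List.all_eq_true.mp cutOrder_adj e he1, ?_⟩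
  cases h1 : f e.1 with
  | true =>
    have h2 : f e.2 = false := by
      rw [h1] at he2
      simpa using he2
    refine ⟨e.1, (hf _).mp h1, e.2, fun h => ?_, rfl⟩
    rw [(hf _).mpr h] at h2
    exact Bool.false_ne_true h2.symm
  | false =>
    have h2 : f e.2 = true := by
      rw [h1] at he2
      simpa using he2
    refine ⟨e.2, (hf _).mp h2, e.1, fun h => ?_, Sym2.eq_swap⟩
    rw [(hf _).mpr h] at h1
    exact Bool.false_ne_true h1.symm

theorem ncard_le_filter (S : Set (Fin 34)) (g : Fin 34 → Bool)
    (hg : ∀ v, v ∈ S → g v = true) :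
    S.ncard ≤ ((cutOrder.map Prod.fst).filter g).length := by
  refine le_trans ?_ (List.toFinset_card_le _)
  rw [← Set.ncard_coe_finset]
  refine Set.ncard_le_ncard ?_ (Set.toFinite _)
  intro v hv
  rw [Finset.mem_coe, List.mem_toFinset, List.mem_filter]
  exact ⟨List.contains_iff_mem.mp (cutOrder_all v), hg v hv⟩

theorem three_le_of_cycle (A : Set (Fin 34)) (h : HasCycleIn theG A) : 3 ≤ A.ncard := by
  obtain ⟨C, ⟨hconn, hreg⟩, hsub⟩ := h
  obtain ⟨v, hv⟩ := hconn.nonempty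
  have h2 := hreg v hv
  have hnot : v ∉ C.neighborSet v := fun h => C.loopless.irrefl v h
  have h3 : (insert v (C.neighborSet v)).ncard = 3 := by
    rw [Set.ncard_insert_of_notMem hnot (Set.toFinite _), h2]
  rw [← h3]
  refine Set.ncard_le_ncard ?_ (Set.toFinite _)
  intro w hw
  rcases hw with rfl | hw
  · exact hsub hv
  · exact hsub (C.edge_vert (SimpleGraph.Subgraph.Adj.symm hw))

theorem theG_cyc5 : CyclEdgeConn theG 5 := by
  intro A h1 h2
  by_contra hlt
  have hA := three_le_of_cycle _ h1
  have hB := three_le_of_cycle _ h2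
  let f : Fin 34 → Bool := fun v => decide (v ∈ A)
  have hf : ∀ v, f v = true ↔ v ∈ A := fun v => decide_eq_true_iff
  have hle := crossTotal_le A f hf
  have hA' := ncard_le_filter A f (fun v hv => (hf v).mpr hv)
  have hB' := ncard_le_filter Aᶜ (fun v => !(f v)) (fun v hv => by
    cases h : f v with
    | true => exact absurd ((hf v).mp h) hv
    | false => rfl)
  have hsum := List.length_eq_length_filter_add (l := cutOrder.map Prod.fst) f
  rw [cutOrder_length] at hsum
  have := cutSearch_sound f cutOrder 0 0 0 0 (fun w hw => by simp at hw)
    (fun w hw => by simp at hw) cutOrder_search (by omega)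
  omega

theorem theG_cyc4 : CyclEdgeConn theG 4 := fun A h1 h2 =>
  le_trans (by norm_num) (theG_cyc5 A h1 h2)

/-! ### Girth -/

theorem no_triangle : ∀ a b : Fin 34, adjB a b = true → ∀ c : Fin 34, adjB b c = true →
    ¬ (adjB c a = true) := by decide +kernel

theorem no_square : ∀ a b : Fin 34, adjB a b = true → ∀ c : Fin 34, adjB b c = true → a ≠ c →
    ∀ d : Fin 34, adjB c d = true → b ≠ d → ¬ (adjB d a = true) := by decide +kernel

theorem five_le_of_cycle {a : Fin 34} (w : theG.Walk a a) (hw : w.IsCycle) : 5 ≤ w.length := by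
  have h3 := hw.three_le_length
  by_contra hlt
  have hnd := hw.support_nodup
  cases w with
  | nil => simp at h3
  | cons h1 w =>
  cases w with
  | nil => simp at h3
  | cons h2 w =>
  cases w with
  | nil => simp at h3
  | cons h3' w =>
  cases w with
  | nil => exact no_triangle _ _ h1 _ h2 h3'
  | cons h4 w =>
  cases w with
  | nil =>
    simp at hnd
    refine no_square _ _ h1 _ h2 ?_ _ h3' ?_ h4
    · intro h; subst h; tauto
    · intro h; subst h; tauto
  | cons h5 w => simp at hlt

theorem theG_girth : 5 ≤ theG.girth := by
  have hna : ¬ theG.IsAcyclic := by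
    intro hac
    have e1 : theG.Adj 32 31 := by rw [theG_adj]; decide +kernel
    have e2 : theG.Adj 31 30 := by rw [theG_adj]; decide +kernel
    have e3 : theG.Adj 30 9 := by rw [theG_adj]; decide +kernel
    have e4 : theG.Adj 9 10 := by rw [theG_adj]; decide +kernel
    have e5 : theG.Adj 10 32 := by rw [theG_adj]; decide +kernel
    refine hac (.cons e1 (.cons e2 (.cons e3 (.cons e4 (.cons e5 .nil))))) ?_
    rw [SimpleGraph.Walk.cons_isCycle_iff]
    simp [SimpleGraph.Walk.isPath_def]
  obtain ⟨a, w, hw, hlen⟩ := SimpleGraph.exists_girth_eq_length.mpr hna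
  rw [hlen]
  exact five_le_of_cycle w hw

/-! ### The permutation 2-factor -/

/-- First cycle. -/
def cycA : theG.Subgraph := (⊤ : theG.Subgraph).induce {v | v.val < 17}

/-- Second cycle. -/
def cycB : theG.Subgraph := (⊤ : theG.Subgraph).induce {v | 17 ≤ v.val}

theorem cycA_adj (v w : Fin 34) : cycA.Adj v w ↔ v.val < 17 ∧ w.val < 17 ∧ adjB v w = true :=
  Iff.rfl

theorem cycB_adj (v w : Fin 34) : cycB.Adj v w ↔ 17 ≤ v.val ∧ 17 ≤ w.val ∧ adjB v w = true :=
  Iff.rfl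

theorem step_adj : ∀ v w : Fin 34, w.val = v.val + 1 → v.val ≠ 16 → adjB v w = true := by
  decide +kernel

theorem cycA_reach (n : ℕ) (hn : n < 17) :
    cycA.coe.Reachable ⟨⟨0, by omega⟩, by simp [cycA]⟩ ⟨⟨n, by omega⟩, hn⟩ := by
  induction n with
  | zero => exact SimpleGraph.Reachable.refl _
  | succ k ih =>
    refine (ih (by omega)).trans (SimpleGraph.Adj.reachable ?_)
    rw [SimpleGraph.Subgraph.coe_adj, cycA_adj]
    exact ⟨by simp; omega, by simp; omega, step_adj _ _ rfl (by simp; omega)⟩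

theorem cycB_reach (n : ℕ) (hn : n < 17) :
    cycB.coe.Reachable ⟨⟨17, by omega⟩, by simp [cycB]⟩
      ⟨⟨17 + n, by omega⟩, by simp [cycB]⟩ := by
  induction n with
  | zero => exact SimpleGraph.Reachable.refl _
  | succ k ih =>
    refine (ih (by omega)).trans (SimpleGraph.Adj.reachable ?_)
    rw [SimpleGraph.Subgraph.coe_adj, cycB_adj]
    exact ⟨by simp, by simp, step_adj _ _ rfl (by simp; omega)⟩

theorem cycA_conn : cycA.Connected := by
  refine ⟨?_⟩
  rw [SimpleGraph.connected_iff_exists_forall_reachable]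
  exact ⟨⟨⟨0, by omega⟩, by simp [cycA]⟩, fun ⟨⟨n, _⟩, h⟩ => cycA_reach n h⟩

theorem cycB_conn : cycB.Connected := by
  refine ⟨?_⟩
  rw [SimpleGraph.connected_iff_exists_forall_reachable]
  refine ⟨⟨⟨17, by omega⟩, by simp [cycB]⟩, fun ⟨⟨n, hn⟩, h⟩ => ?_⟩
  have h1 : 17 ≤ n := h
  obtain ⟨k, rfl⟩ := Nat.exists_eq_add_of_le h1
  exact cycB_reach k (by omega)

/-- Adjacency inside one of the two cycles. -/
def facB (v w : Fin 34) : Bool := (Nat.blt v.val 17 == Nat.blt w.val 17) && adjB v w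

theorem facB_count : ∀ v : Fin 34, ((List.finRange 34).filter (facB v)).length = 2 := by
  decide +kernel

theorem facB_iff (v w : Fin 34) :
    facB v w = true ↔ (v.val < 17 ↔ w.val < 17) ∧ adjB v w = true := by
  rw [facB, Bool.and_eq_true, beq_iff_eq, Bool.eq_iff_iff, Nat.blt_eq, Nat.blt_eq]

theorem cycA_reg : IsTwoRegular cycA := by
  intro v hv
  have hv' : v.val < 17 := hv
  refine ncard_of_filter _ (facB v) 2 (fun w => ?_) (facB_count v)
  rw [SimpleGraph.Subgraph.mem_neighborSet, cycA_adj, facB_iff]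
  tauto

theorem cycB_reg : IsTwoRegular cycB := by
  intro v hv
  have hv' : 17 ≤ v.val := hv
  refine ncard_of_filter _ (facB v) 2 (fun w => ?_) (facB_count v)
  rw [SimpleGraph.Subgraph.mem_neighborSet, cycB_adj, facB_iff, ← not_lt, ← not_lt]
  rw [← not_lt] at hv'
  tauto

theorem theG_perm : IsPermutationGraph theG := by
  refine ⟨theG_cubic, cycA, cycB, ⟨cycA_conn, cycA_reg⟩, ⟨cycB_conn, cycB_reg⟩, ?_, ?_, ?_, ?_, ?_⟩
  · intro v hv w hw h
    exact ⟨hv, hw, h⟩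
  · intro v hv w hw h
    exact ⟨hv, hw, h⟩
  · rw [Set.disjoint_left]
    intro v hv hw
    have h1 : v.val < 17 := hv
    have h2 : 17 ≤ v.val := hw
    omega
  · intro v
    rcases lt_or_ge v.val 17 with h | h
    · exact Or.inl h
    · exact Or.inr h
  · intro v _
    refine ncard_of_filter _ (facB v) 2 (fun w => ?_) (facB_count v)
    rw [SimpleGraph.Subgraph.mem_neighborSet, SimpleGraph.Subgraph.sup_adj, cycA_adj, cycB_adj,
      facB_iff, ← not_lt, ← not_lt]
    tauto

/-- there exists a cyclically 5-edge-connected permutation snark on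
34 vertices (refuting Zhang's conjecture that the Petersen graph is the only one). -/
theorem exists_cyc5_permutation_snark_34 :
    ∃ G : SimpleGraph (Fin 34),
      IsSnark G ∧ CyclEdgeConn G 5 ∧ IsPermutationGraph G := by
  exact ⟨theG, ⟨theG_cubic, theG_uncol, theG_cyc4, theG_girth⟩, theG_cyc5, theG_perm⟩

end SnarkPaper
end
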